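/- arXiv:2601.08362 — 2 statements merged into one kernel-verified Lean document; each statement's English description precedes it below -/
import Mathlib

section
/- Let g : ℝ^m → S^n be infinitely differentiable (C^∞). For b ∈ S^n define g_b(x) := g(x) + b. Then the set of all b ∈ S^n such that, for every (x,y) ∈ ℝ^m × S^n with g_b(x) positive semidefinite, y negative semidefinite and ⟨g_b(x), y⟩ = 0, the W-SRCQ for the data g_b holds at (x,y), is residual in S^n (i.e., it contains a countable intersection of dense open subsets of S^n). -/
open scoped Classical RealInnerProductSpace
open Matrix Set

noncomputable section

abbrev Mat (n : ℕ) : Type := Matrix (Fin n) (Fin n) ℝ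

abbrev Em (m : ℕ) : Type := EuclideanSpace ℝ (Fin m)

attribute [instance] Matrix.frobeniusNormedAddCommGroup Matrix.frobeniusNormedSpace

/-- The trace (Frobenius) inner product `⟨A,B⟩ = tr(AᵀB)` on matrices; for symmetric
matrices this is `tr(AB)`. -/
def minner {n : ℕ} (A B : Mat n) : ℝ := (Aᵀ * B).trace

/-- `P` is an orthogonal matrix. -/
def IsOrthoMat {n : ℕ} (P : Mat n) : Prop := P * Pᵀ = 1 ∧ Pᵀ * P = 1

/-- `(P, lam)` is an eigenvalue decomposition of `A` with orthogonal `P` and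
nonincreasing eigenvalue vector `lam`: `A = P·Diag(lam)·Pᵀ`. -/
def IsEigDecomp {n : ℕ} (A P : Mat n) (lam : Fin n → ℝ) : Prop :=
  IsOrthoMat P ∧ Antitone lam ∧ A = P * Matrix.diagonal lam * Pᵀ

/-- The stratum `M_{p,q}` of symmetric matrices with exactly `p` positive and `q` negative
eigenvalues. -/
def stratum (n p q : ℕ) : Set (Mat n) :=
  {A | ∃ P lam, IsEigDecomp A P lam ∧
    {i : Fin n | 0 < lam i}.ncard = p ∧ {i : Fin n | lam i < 0}.ncard = q}

/-- The metric projection `Π₊` onto the positive semidefinite cone (defined through an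
eigenvalue decomposition; the value is independent of the choice of decomposition). -/
noncomputable def piPlus {n : ℕ} (A : Mat n) : Mat n :=
  if h : ∃ P lam, IsEigDecomp A P lam then
    h.choose * Matrix.diagonal (fun i => max (h.choose_spec.choose i) 0) * h.chooseᵀ
  else 0

variable {m n : ℕ}

/-- `G(z) = g(x) + y`. -/
def Gmap (g : Em m → Mat n) (z : Em m × Mat n) : Mat n := g z.1 + z.2

/-- The adjoint `∇g(x) : Sⁿ → ℝᵐ` of the derivative `g'(x)`, characterized by
`⟨∇g(x)H, v⟩ = ⟨H, g'(x)v⟩`. -/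
def gradg (g : Em m → Mat n) (x : Em m) (H : Mat n) : Em m :=
  (EuclideanSpace.equiv (Fin m) ℝ).symm
    fun k => (Hᵀ * fderiv ℝ g x (EuclideanSpace.single k 1)).trace

/-- The Lagrangian `L(x,y) = f(x) + ⟨y, g(x)⟩`. -/
def Lfun (f : Em m → ℝ) (g : Em m → Mat n) (x : Em m) (y : Mat n) : ℝ :=
  f x + minner y (g x)

/-- The Hessian `∇²ₓₓL(x,y)` of `x ↦ L(x,y)`, as a continuous linear map `ℝᵐ → ℝᵐ`. -/
def hessL (f : Em m → ℝ) (g : Em m → Mat n) (x : Em m) (y : Mat n) : Em m →L[ℝ] Em m :=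
  fderiv ℝ (fun u => gradient (fun w => Lfun f g w y) u) x

/-- The KKT mapping `F(z) = (∇f(x) + ∇g(x)y, −g(x) + Π₊(G(z)))`. -/
def KKTF (f : Em m → ℝ) (g : Em m → Mat n) (z : Em m × Mat n) : Em m × Mat n :=
  (gradient f z.1 + gradg g z.1 z.2, - g z.1 + piPlus (Gmap g z))

/-- The lifted stratum `M̃_{p,q} = {z = (x,y) ∈ ℝᵐ × Sⁿ : G(z) ∈ M_{p,q}}`. -/
def lstratum (g : Em m → Mat n) (p q : ℕ) : Set (Em m × Mat n) :=
  {z | z.2.IsSymm ∧ Gmap g z ∈ stratum n p q}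

/-- The norm `‖(u,H)‖ = sqrt(‖u‖² + ‖H‖²)` on `ℝᵐ × Sⁿ` (Frobenius norm on matrices). -/
def pnorm {m n : ℕ} (w : Em m × Mat n) : ℝ := Real.sqrt (‖w.1‖ ^ 2 + ‖w.2‖ ^ 2)

/-- The weak strict Robinson constraint qualification (W-SRCQ) at `z`:
`g'(x)[ℝᵐ] + {PBPᵀ : B ∈ Sⁿ, B_{βγ} = 0, B_{γγ} = 0} = Sⁿ`
(for any eigenvalue decomposition `(P, lam)` of `G(z)`; independent of the choice). -/
def WSRCQ (g : Em m → Mat n) (z : Em m × Mat n) : Prop :=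
  ∀ P lam, IsEigDecomp (Gmap g z) P lam →
    ∀ C : Mat n, C.IsSymm →
      ∃ (v : Em m) (B : Mat n), B.IsSymm ∧
        (∀ i j, lam i = 0 → lam j < 0 → B i j = 0) ∧
        (∀ i j, lam i < 0 → lam j < 0 → B i j = 0) ∧
        C = fderiv ℝ g z.1 v + P * B * Pᵀ

/-- The constraint nondegeneracy at `z`:
`g'(x)[ℝᵐ] + {PBPᵀ : B ∈ Sⁿ, B_{ββ} = 0, B_{βγ} = 0, B_{γγ} = 0} = Sⁿ`. -/
def CNondeg (g : Em m → Mat n) (z : Em m × Mat n) : Prop :=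
  ∀ P lam, IsEigDecomp (Gmap g z) P lam →
    ∀ C : Mat n, C.IsSymm →
      ∃ (v : Em m) (B : Mat n), B.IsSymm ∧
        (∀ i j, lam i = 0 → lam j = 0 → B i j = 0) ∧
        (∀ i j, lam i = 0 → lam j < 0 → B i j = 0) ∧
        (∀ i j, lam i < 0 → lam j < 0 → B i j = 0) ∧
        C = fderiv ℝ g z.1 v + P * B * Pᵀ

/-- The strict Robinson constraint qualification (SRCQ) at a KKT pair `z`:
`g'(x)[ℝᵐ] + {PBPᵀ : B ∈ Sⁿ, B_{ββ} ⪰ 0, B_{βγ} = 0, B_{γγ} = 0} = Sⁿ`. -/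
def SRCQ (g : Em m → Mat n) (z : Em m × Mat n) : Prop :=
  ∀ P lam, IsEigDecomp (Gmap g z) P lam →
    ∀ C : Mat n, C.IsSymm →
      ∃ (v : Em m) (B : Mat n), B.IsSymm ∧
        (∀ u : Fin n → ℝ, (∀ i, lam i ≠ 0 → u i = 0) →
          0 ≤ ∑ i, ∑ j, u i * B i j * u j) ∧
        (∀ i j, lam i = 0 → lam j < 0 → B i j = 0) ∧
        (∀ i j, lam i < 0 → lam j < 0 → B i j = 0) ∧
        C = fderiv ℝ g z.1 v + P * B * Pᵀ

/-- The quadratic form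
`Q(z,v) = ⟨v, ∇²ₓₓL(x,y)v⟩ + 2·Σ_{i∈α}Σ_{j∈γ} (−λⱼ/λᵢ)·([Pᵀ(g'(x)v)P]_{ij})²`. -/
def Qform (f : Em m → ℝ) (g : Em m → Mat n) (z : Em m × Mat n)
    (P : Mat n) (lam : Fin n → ℝ) (v : Em m) : ℝ :=
  ⟪v, hessL f g z.1 z.2 v⟫ +
    2 * ∑ i : Fin n, ∑ j : Fin n,
      (if 0 < lam i ∧ lam j < 0 then
        (-lam j / lam i) * ((Pᵀ * fderiv ℝ g z.1 v * P) i j) ^ 2 else 0)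

/-- `v ∈ appl(z)`: the blocks `ββ`, `βγ`, `γγ` of `Pᵀ(g'(x)v)P` vanish. -/
def memAppl (g : Em m → Mat n) (z : Em m × Mat n)
    (P : Mat n) (lam : Fin n → ℝ) (v : Em m) : Prop :=
  (∀ i j, lam i = 0 → lam j = 0 → (Pᵀ * fderiv ℝ g z.1 v * P) i j = 0) ∧
  (∀ i j, lam i = 0 → lam j < 0 → (Pᵀ * fderiv ℝ g z.1 v * P) i j = 0) ∧
  (∀ i j, lam i < 0 → lam j < 0 → (Pᵀ * fderiv ℝ g z.1 v * P) i j = 0)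

/-- `v ∈ app(z)`: the blocks `βγ`, `γγ` of `Pᵀ(g'(x)v)P` vanish. -/
def memApp (g : Em m → Mat n) (z : Em m × Mat n)
    (P : Mat n) (lam : Fin n → ℝ) (v : Em m) : Prop :=
  (∀ i j, lam i = 0 → lam j < 0 → (Pᵀ * fderiv ℝ g z.1 v * P) i j = 0) ∧
  (∀ i j, lam i < 0 → lam j < 0 → (Pᵀ * fderiv ℝ g z.1 v * P) i j = 0)

/-- The weak second order condition (W-SOC) at `z`: `Q(z,v) ≠ 0` for every nonzero
`v ∈ appl(z)`. -/
def WSOC (f : Em m → ℝ) (g : Em m → Mat n) (z : Em m × Mat n) : Prop :=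
  ∀ P lam, IsEigDecomp (Gmap g z) P lam →
    ∀ v : Em m, v ≠ 0 → memAppl g z P lam v → Qform f g z P lam v ≠ 0

/-- The strong second order sufficient condition (S-SOSC) at `z`: `Q(z,v) > 0` for every
nonzero `v ∈ app(z)`. -/
def SSOSC (f : Em m → ℝ) (g : Em m → Mat n) (z : Em m × Mat n) : Prop :=
  ∀ P lam, IsEigDecomp (Gmap g z) P lam →
    ∀ v : Em m, v ≠ 0 → memApp g z P lam v → 0 < Qform f g z P lam v

/-- The second order necessary condition (SONC) at `z`. -/
def SONC (f : Em m → ℝ) (g : Em m → Mat n) (z : Em m × Mat n) : Prop :=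
  ∀ P lam, IsEigDecomp (Gmap g z) P lam →
    ∀ v : Em m, v ≠ 0 →
      (∀ u : Fin n → ℝ, (∀ i, lam i ≠ 0 → u i = 0) →
        0 ≤ ∑ i, ∑ j, u i * (Pᵀ * fderiv ℝ g z.1 v * P) i j * u j) →
      memApp g z P lam v → 0 ≤ Qform f g z P lam v

/-- The W-SOC holds uniformly on a set `S`: there is `c > 0` with `Q(z,v) ≥ c‖v‖²` for
every `z ∈ S` (in `ℝᵐ × Sⁿ`) and every `v ∈ appl(z)`. -/
def UnifWSOC (f : Em m → ℝ) (g : Em m → Mat n) (S : Set (Em m × Mat n)) : Prop :=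
  ∃ c : ℝ, 0 < c ∧ ∀ z ∈ S, z.2.IsSymm →
    ∀ P lam, IsEigDecomp (Gmap g z) P lam →
      ∀ v : Em m, memAppl g z P lam v → c * ‖v‖ ^ 2 ≤ Qform f g z P lam v

/-- `H ∈ T_z`: `H ∈ Sⁿ` with `(PᵀHP)_{ββ} = 0`. -/
def memTz {n : ℕ} (P : Mat n) (lam : Fin n → ℝ) (H : Mat n) : Prop :=
  H.IsSymm ∧ ∀ i j, lam i = 0 → lam j = 0 → (Pᵀ * H * P) i j = 0

/-- `Δ ∈ N_{G(z)}M_{p,q}`: `Δ ∈ Sⁿ` and `(PᵀΔP)_{ij} = 0` whenever `i ∉ β` or `j ∉ β`. -/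
def memNormal {n : ℕ} (P : Mat n) (lam : Fin n → ℝ) (Δ : Mat n) : Prop :=
  Δ.IsSymm ∧ ∀ i j, (lam i ≠ 0 ∨ lam j ≠ 0) → (Pᵀ * Δ * P) i j = 0

/-- The map `ξ_z : T_z → Sⁿ`, `ξ_z(H) = P·M·Pᵀ`. -/
def xiMap {n : ℕ} (P : Mat n) (lam : Fin n → ℝ) (H : Mat n) : Mat n :=
  P * (Matrix.of fun i j =>
    if 0 < lam i ∧ 0 < lam j then (Pᵀ * H * P) i j
    else if 0 < lam i ∧ lam j = 0 then (Pᵀ * H * P) i j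
    else if lam i = 0 ∧ 0 < lam j then (Pᵀ * H * P) i j
    else if 0 < lam i ∧ lam j < 0 then (lam i / (lam i - lam j)) * (Pᵀ * H * P) i j
    else if lam i < 0 ∧ 0 < lam j then (lam j / (lam j - lam i)) * (Pᵀ * H * P) i j
    else 0) * Pᵀ

/-- The linear map `𝒜_z(v,H) = (∇²ₓₓL(x,y)v − ∇g(x)(g'(x)v) + ∇g(x)H, −g'(x)v + ξ_z(H))`. -/
def Amap (f : Em m → ℝ) (g : Em m → Mat n) (z : Em m × Mat n)
    (P : Mat n) (lam : Fin n → ℝ) (v : Em m) (H : Mat n) : Em m × Mat n :=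
  (hessL f g z.1 z.2 v - gradg g z.1 (fderiv ℝ g z.1 v) + gradg g z.1 H,
    - fderiv ℝ g z.1 v + xiMap P lam H)

/-- The positive inertia index of `A` is `p`. -/
def posInertiaIs {n : ℕ} (A : Mat n) (p : ℕ) : Prop :=
  ∃ P lam, IsEigDecomp A P lam ∧ {i : Fin n | 0 < lam i}.ncard = p

/-- The negative inertia index of `A` is `q`. -/
def negInertiaIs {n : ℕ} (A : Mat n) (q : ℕ) : Prop :=
  ∃ P lam, IsEigDecomp A P lam ∧ {i : Fin n | lam i < 0}.ncard = q

end

section Sard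

open MeasureTheory Topology Filter Module
open scoped ContDiff

section Flat

variable {E : Type*} [NormedAddCommGroup E] [NormedSpace ℝ E]

/-- If all derivatives of `φ` of orders `1, …, k` vanish at `x`, and the derivative of order `k + 1`
is bounded by `C` on a convex set containing `x`, then `φ y - φ x` is `O(‖y - x‖ ^ (k + 1))` there. -/
theorem norm_sub_le_of_iteratedFDeriv_eq_zero {φ : E → ℝ} {V : Set E} {k : ℕ} {C : ℝ}
    (hV : Convex ℝ V) (hφ : ∀ y ∈ V, ContDiffAt ℝ (k + 1 : ℕ) φ y)
    (hC : ∀ y ∈ V, ‖iteratedFDeriv ℝ (k + 1) φ y‖ ≤ C) {x : E} (hx : x ∈ V)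
    (h0 : ∀ j, 1 ≤ j → j ≤ k → iteratedFDeriv ℝ j φ x = 0) {y : E} (hy : y ∈ V) :
    ‖φ y - φ x‖ ≤ C * ‖y - x‖ ^ (k + 1) := by
  have hC0 : 0 ≤ C := (norm_nonneg _).trans (hC x hx)
  have mvt : ∀ j ≤ k, ∀ i,
      (∀ y ∈ V, ‖iteratedFDeriv ℝ (j + 1) φ y‖ ≤ C * ‖y - x‖ ^ i) →
      ∀ y ∈ V, ‖iteratedFDeriv ℝ j φ y - iteratedFDeriv ℝ j φ x‖ ≤ C * ‖y - x‖ ^ (i + 1) := by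
    intro j hj i hb y hy
    have := Convex.norm_image_sub_le_of_norm_fderiv_le (𝕜 := ℝ) (f := iteratedFDeriv ℝ j φ)
      (C := C * ‖y - x‖ ^ i) (s := V ∩ Metric.closedBall x ‖y - x‖) (x := x) (y := y) ?_ ?_
      (hV.inter (convex_closedBall _ _)) ⟨hx, by simp⟩ ⟨hy, by simp [dist_eq_norm]⟩
    · rw [pow_succ, ← mul_assoc]; exact this
    · intro z hz
      have : ContDiffAt ℝ 1 (iteratedFDeriv ℝ j φ) z :=
        (hφ z hz.1).iteratedFDeriv_right (by norm_cast; omega)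
      exact this.differentiableAt (by simp)
    · intro z hz
      rw [norm_fderiv_iteratedFDeriv]
      refine (hb z hz.1).trans ?_
      have : ‖z - x‖ ≤ ‖y - x‖ := by simpa [dist_eq_norm] using hz.2
      gcongr
  have main : ∀ i j, j + i = k →
      ∀ y ∈ V, ‖iteratedFDeriv ℝ (j + 1) φ y‖ ≤ C * ‖y - x‖ ^ i := by
    intro i
    induction i with
    | zero => rintro j rfl y hy; simpa using hC y hy
    | succ i ih =>
      intro j hj y hy
      have := mvt (j + 1) (by omega) i (ih (j + 1) (by omega)) y hy
      rwa [h0 (j + 1) (by omega) (by omega), sub_zero] at this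
  have := mvt 0 (Nat.zero_le _) k (main k 0 (by simp)) y hy
  rwa [iteratedFDeriv_zero_eq_comp, Function.comp_apply, Function.comp_apply, ← map_sub,
    LinearIsometryEquiv.norm_map] at this

/-- The image of the set of points where all derivatives of orders `1, …, dim E` vanish is null. -/
theorem volume_image_eq_zero_of_iteratedFDeriv_eq_zero [FiniteDimensional ℝ E] {φ : E → ℝ}
    {s : Set E} (hφ : ∀ x ∈ s, ContDiffAt ℝ ∞ φ x)
    (h0 : ∀ x ∈ s, ∀ j, 1 ≤ j → j ≤ finrank ℝ E → iteratedFDeriv ℝ j φ x = 0) :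
    volume (φ '' s) = 0 := by
  set k := finrank ℝ E with hk
  have hdim : dimH (φ '' s) ≤ dimH s / ((k + 1 : ℕ) : NNReal) := by
    refine dimH_image_le_of_locally_holder_on (by positivity) fun x hx => ?_
    have h1 : ContDiffAt ℝ (k + 1 : ℕ) φ x := (hφ x hx).of_le (by exact_mod_cast le_top)
    have hcont : ContinuousAt (fun y => ‖iteratedFDeriv ℝ (k + 1) φ y‖) x :=
      (ContDiffAt.continuousAt (n := 0)
        ((hφ x hx).iteratedFDeriv_right (i := k + 1)
          (by exact_mod_cast le_top))).norm
    have hev : ∀ᶠ y in 𝓝 x, ContDiffAt ℝ (k + 1 : ℕ) φ y ∧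
        ‖iteratedFDeriv ℝ (k + 1) φ y‖ ≤ ‖iteratedFDeriv ℝ (k + 1) φ x‖ + 1 :=
      (h1.eventually (by simp)).and
        ((hcont.eventually_lt continuousAt_const (lt_add_one _)).mono fun _ h => h.le)
    obtain ⟨ε, hε, hball⟩ := Metric.eventually_nhds_iff_ball.1 hev
    refine ⟨⟨‖iteratedFDeriv ℝ (k + 1) φ x‖ + 1, by positivity⟩, s ∩ Metric.ball x ε,
      inter_mem self_mem_nhdsWithin (mem_nhdsWithin_of_mem_nhds (Metric.ball_mem_nhds x hε)), ?_⟩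
    intro y hy z hz
    have := norm_sub_le_of_iteratedFDeriv_eq_zero (convex_ball x ε) (fun y hy => (hball y hy).1)
      (fun y hy => (hball y hy).2) hz.2 (h0 z hz.1) hy.2
    rw [← dist_eq_norm, ← dist_eq_norm] at this
    rw [edist_dist, edist_dist, NNReal.coe_natCast, ENNReal.rpow_natCast,
      ← ENNReal.ofReal_pow dist_nonneg]
    refine (ENNReal.ofReal_le_ofReal this).trans ?_
    rw [ENNReal.ofReal_mul (by positivity)]
    gcongr
    rw [ENNReal.ofReal_eq_coe_nnreal (by positivity)]
    exact le_rfl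
  have hs : dimH s ≤ k := (dimH_mono (subset_univ s)).trans (Real.dimH_univ_eq_finrank E).le
  have hlt : dimH (φ '' s) < ((1 : NNReal) : ENNReal) := by
    refine hdim.trans_lt ?_
    refine ENNReal.div_lt_of_lt_mul ?_
    refine hs.trans_lt ?_
    norm_cast
    simp
  have := hausdorffMeasure_of_dimH_lt hlt
  rwa [NNReal.coe_one, hausdorffMeasure_real] at this

end Flat

section Straighten

variable {E : Type*} [NormedAddCommGroup E] [NormedSpace ℝ E] [CompleteSpace E]

/-- A real function with nonzero derivative at `x₀` becomes its own linear part after a local change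
of coordinates. -/
theorem exists_openPartialHomeomorph_straighten {w : E → ℝ} {x₀ v : E}
    (hw : ContDiffAt ℝ ∞ w x₀) (hv : fderiv ℝ w x₀ v = 1) :
    ∃ h : OpenPartialHomeomorph E E, x₀ ∈ h.source ∧
      (∀ x, fderiv ℝ w x₀ (h x) = w x) ∧
      (∀ x ∈ h.source, ContDiffAt ℝ ∞ w x → ContDiffAt ℝ ∞ h x) ∧
      (∀ x ∈ h.source, ContDiffAt ℝ ∞ w x → ContDiffAt ℝ ∞ h.symm (h x)) := by
  set A := fderiv ℝ w x₀ with hA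
  set H : E → E := fun x => x + (w x - A x) • v with hH
  have hHs : ∀ {n : WithTop ℕ∞} {x}, ContDiffAt ℝ n w x → ContDiffAt ℝ n H x := by
    intro n x hx
    exact contDiffAt_id.add ((hx.sub A.contDiff.contDiffAt).smul contDiffAt_const)
  have hder : HasFDerivAt H ((ContinuousLinearEquiv.refl ℝ E : E ≃L[ℝ] E) : E →L[ℝ] E) x₀ := by
    have h1 := (hasFDerivAt_id (𝕜 := ℝ) x₀).add
      ((((hw.differentiableAt (by simp)).hasFDerivAt).sub A.hasFDerivAt).smul_const v)
    refine h1.congr_fderiv ?_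
    ext y
    simp [← hA]
  have hcont : ContinuousAt (fderiv ℝ H) x₀ :=
    ((hHs hw).fderiv_right (m := 0) (by simp)).continuousAt
  have hinv : ∀ᶠ x in 𝓝 x₀, fderiv ℝ H x ∈
      range (ContinuousLinearEquiv.toContinuousLinearMap : (E ≃L[ℝ] E) → E →L[ℝ] E) := by
    apply hcont
    rw [hder.fderiv]
    exact ContinuousLinearEquiv.nhds _
  obtain ⟨u, hu, huo, hxu⟩ := eventually_nhds_iff.1 hinv
  set h0 := (hHs hw).toOpenPartialHomeomorph H hder (by simp) with hh0
  have hcoe : (h0 : E → E) = H := ContDiffAt.toOpenPartialHomeomorph_coe _ _ _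
  have hx0 : x₀ ∈ h0.source := ContDiffAt.mem_toOpenPartialHomeomorph_source _ _ _
  refine ⟨h0.restrOpen u huo, ⟨hx0, hxu⟩, ?_, ?_, ?_⟩
  · intro x
    change A (h0 x) = w x
    rw [hcoe]
    simp [hH, hv]
  · intro x hx hwx
    change ContDiffAt ℝ ∞ h0 x
    rw [hcoe]
    exact hHs hwx
  · intro x hx hwx
    obtain ⟨e, he⟩ := hu x hx.2
    have hxs : (h0.restrOpen u huo).symm ((h0.restrOpen u huo) x) = x :=
      (h0.restrOpen u huo).left_inv hx
    refine OpenPartialHomeomorph.contDiffAt_symm (f₀' := e) _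
      ((h0.restrOpen u huo).map_source hx) ?_ ?_
    · rw [hxs]
      change HasFDerivAt h0 _ _
      rw [hcoe, he]
      exact ((hHs hwx).differentiableAt (by simp)).hasFDerivAt
    · rw [hxs]
      change ContDiffAt ℝ ∞ h0 x
      rw [hcoe]
      exact hHs hwx

end Straighten

theorem measure_image_eq_zero_of_locally {E F : Type*} [TopologicalSpace E]
    [SecondCountableTopology E] [MeasurableSpace F] {μ : Measure F} {φ : E → F} {s : Set E}
    (h : ∀ x ∈ s, ∃ t ∈ 𝓝[s] x, μ (φ '' (s ∩ t)) = 0) : μ (φ '' s) = 0 := by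
  choose! t ht h0 using h
  obtain ⟨c, hcs, hc, hsub⟩ := TopologicalSpace.countable_cover_nhdsWithin ht
  refine measure_mono_null (t := ⋃ x ∈ c, φ '' (s ∩ t x)) ?_
    ((measure_biUnion_null_iff hc).2 fun x hx => h0 x (hcs hx))
  rintro _ ⟨x, hx, rfl⟩
  obtain ⟨i, hi, hxi⟩ := mem_iUnion₂.1 (hsub hx)
  exact mem_iUnion₂.2 ⟨i, hi, x, ⟨hx, hxi⟩, rfl⟩

theorem finrank_ker_of_apply_eq_one {E : Type*} [NormedAddCommGroup E] [NormedSpace ℝ E]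
    [FiniteDimensional ℝ E] {A : E →L[ℝ] ℝ} {v : E} (hv : A v = 1) :
    finrank ℝ A.ker + 1 = finrank ℝ E := by
  have hs : Function.Surjective (A : E →ₗ[ℝ] ℝ) := fun t => ⟨t • v, by simp [hv]⟩
  have := LinearMap.finrank_range_add_finrank_ker (A : E →ₗ[ℝ] ℝ)
  rw [LinearMap.range_eq_top.2 hs, finrank_top, finrank_self] at this
  rw [add_comm]
  exact this

/-- **Morse's theorem**: the set of critical values of a smooth real function is null. -/
theorem volume_image_eq_zero_of_fderiv_eq_zero.{u} (n : ℕ) :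
    ∀ (E : Type u) [NormedAddCommGroup E] [NormedSpace ℝ E] [FiniteDimensional ℝ E],
      finrank ℝ E = n → ∀ (φ : E → ℝ) (s : Set E), (∀ x ∈ s, ContDiffAt ℝ ∞ φ x) →
        (∀ x ∈ s, fderiv ℝ φ x = 0) → volume (φ '' s) = 0 := by
  induction n with
  | zero =>
    intro E _ _ _ hE φ s hφ h0
    exact volume_image_eq_zero_of_iteratedFDeriv_eq_zero hφ fun x hx j h1 h2 => by omega
  | succ n ih =>
    intro E _ _ _ hE φ s hφ h0
    set S : ℕ → Set E := fun i =>
      {x ∈ s | iteratedFDeriv ℝ i φ x = 0 ∧ iteratedFDeriv ℝ (i + 1) φ x ≠ 0}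
    set T : Set E := {x ∈ s | ∀ j, 1 ≤ j → j ≤ finrank ℝ E → iteratedFDeriv ℝ j φ x = 0}
    have hcover : s ⊆ T ∪ ⋃ i, S i := by
      intro x hx
      by_cases hxT : x ∈ T
      · exact Or.inl hxT
      · right
        have hex : ∃ j, 1 ≤ j ∧ iteratedFDeriv ℝ j φ x ≠ 0 := by
          by_contra! hcon
          exact hxT ⟨hx, fun j hj _ => hcon j hj⟩
        obtain ⟨hj1, hj2⟩ := Nat.find_spec hex
        have hmin : ∀ i, i < Nat.find hex → ¬ (1 ≤ i ∧ iteratedFDeriv ℝ i φ x ≠ 0) :=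
          fun i hi => Nat.find_min hex hi
        generalize Nat.find hex = j at hj1 hj2 hmin
        obtain ⟨i, rfl⟩ : ∃ i, j = i + 1 := ⟨j - 1, by omega⟩
        refine mem_iUnion.2 ⟨i, hx, ?_, hj2⟩
        rcases Nat.eq_zero_or_pos i with rfl | hi
        · exfalso
          apply hj2
          rw [← norm_eq_zero, ← norm_fderiv_iteratedFDeriv]
          have : fderiv ℝ (iteratedFDeriv ℝ 0 φ) x = 0 := by
            rw [iteratedFDeriv_zero_eq_comp, LinearIsometryEquiv.comp_fderiv, h0 x hx]
            simp
          rw [this]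
          exact ContinuousLinearMap.opNorm_zero
        · by_contra hne
          exact hmin i (by omega) ⟨hi, hne⟩
    refine measure_mono_null (image_mono hcover) ?_
    rw [image_union, image_iUnion]
    refine measure_union_null ?_ (measure_iUnion_null fun i => ?_)
    · exact volume_image_eq_zero_of_iteratedFDeriv_eq_zero (fun x hx => hφ x hx.1)
        fun x hx => hx.2
    refine measure_image_eq_zero_of_locally fun x₀ hx₀ => ?_
    obtain ⟨hx₀s, -, hne⟩ := hx₀
    have hD : fderiv ℝ (iteratedFDeriv ℝ i φ) x₀ ≠ 0 := by
      intro hD0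
      apply hne
      rw [← norm_eq_zero, ← norm_fderiv_iteratedFDeriv, hD0]
      exact ContinuousLinearMap.opNorm_zero
    obtain ⟨v, hv⟩ : ∃ v, fderiv ℝ (iteratedFDeriv ℝ i φ) x₀ v ≠ 0 := by
      by_contra! hcon
      exact hD (ContinuousLinearMap.ext hcon)
    obtain ⟨ℓ, hℓ⟩ := SeparatingDual.exists_eq_one (R := ℝ) hv
    set w : E → ℝ := fun x => ℓ (iteratedFDeriv ℝ i φ x) with hw
    have hws : ∀ x ∈ s, ContDiffAt ℝ ∞ w x := fun x hx =>
      ℓ.contDiff.contDiffAt.comp x ((hφ x hx).iteratedFDeriv_right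
      (by exact_mod_cast le_top))
    have hwv : fderiv ℝ w x₀ v = 1 := by
      have hd : DifferentiableAt ℝ (iteratedFDeriv ℝ i φ) x₀ :=
        ((hφ x₀ hx₀s).iteratedFDeriv_right (m := ∞)
          (by exact_mod_cast le_top)).differentiableAt (by simp)
      have := (ℓ.hasFDerivAt.comp x₀ hd.hasFDerivAt).fderiv
      change fderiv ℝ (ℓ ∘ iteratedFDeriv ℝ i φ) x₀ v = 1
      rw [this]
      exact hℓ
    obtain ⟨h, hxh, hlin, -, hsymm⟩ := exists_openPartialHomeomorph_straighten (hws x₀ hx₀s) hwv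
    set A := fderiv ℝ w x₀
    refine ⟨h.source, mem_nhdsWithin_of_mem_nhds (h.open_source.mem_nhds hxh), ?_⟩
    have hdim := finrank_ker_of_apply_eq_one hwv
    set ψ : A.ker → ℝ := fun z => φ (h.symm z) with hψ
    have key : ∀ z : A.ker, (∃ x ∈ S i ∩ h.source, h x = z) →
        ContDiffAt ℝ ∞ ψ z ∧ fderiv ℝ ψ z = 0 := by
      rintro z ⟨x, ⟨hxS, hxs⟩, hxz⟩
      have hz : h.symm (z : E) = x := by rw [← hxz, h.left_inv hxs]
      have h1 : ContDiffAt ℝ ∞ h.symm (z : E) := by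
        rw [← hxz]; exact hsymm x hxs (hws x hxS.1)
      have h2 : ContDiffAt ℝ ∞ (fun z : A.ker => h.symm (z : E)) z :=
        ContDiffAt.comp z h1 A.ker.subtypeL.contDiff.contDiffAt
      have h3 : ContDiffAt ℝ ∞ φ (h.symm (z : E)) := by rw [hz]; exact hφ x hxS.1
      refine ⟨ContDiffAt.comp z h3 h2, ?_⟩
      have h4 := (HasFDerivAt.comp z (h3.differentiableAt (by simp)).hasFDerivAt
        (h2.differentiableAt (by simp)).hasFDerivAt).fderiv
      rw [hz, h0 x hxS.1, ContinuousLinearMap.zero_comp] at h4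
      exact h4
    refine measure_mono_null ?_ (ih A.ker (by omega) ψ {z | ∃ x ∈ S i ∩ h.source, h x = z}
      (fun z hz => (key z hz).1) fun z hz => (key z hz).2)
    rintro _ ⟨x, hx, rfl⟩
    have hmem : h x ∈ A.ker := by
      have : A (h x) = 0 := by
        rw [hlin, hw]
        simp only
        rw [hx.1.2.1, map_zero]
      exact this
    exact ⟨⟨h x, hmem⟩, ⟨x, hx, rfl⟩, by simp [hψ, h.left_inv hx.2]⟩


theorem isMeagre_image_of_locally {E F : Type*} [TopologicalSpace E]
    [SecondCountableTopology E] [TopologicalSpace F] {f : E → F} {s : Set E}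
    (h : ∀ x ∈ s, ∃ t ∈ 𝓝[s] x, IsMeagre (f '' (s ∩ t))) : IsMeagre (f '' s) := by
  choose! t ht h0 using h
  obtain ⟨c, hcs, hc, hsub⟩ := TopologicalSpace.countable_cover_nhdsWithin ht
  refine IsMeagre.mono (s := ⋃ x ∈ c, f '' (s ∩ t x)) ?_
    (isMeagre_biUnion hc fun x hx => h0 x (hcs hx))
  rintro _ ⟨x, hx, rfl⟩
  obtain ⟨i, hi, hxi⟩ := mem_iUnion₂.1 (hsub hx)
  exact mem_iUnion₂.2 ⟨i, hi, x, ⟨hx, hxi⟩, rfl⟩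

theorem IsClosed.isMeagre_of_interior_eq_empty {X : Type*} [TopologicalSpace X] {s : Set X}
    (hs : IsClosed s) (h : interior s = ∅) : IsMeagre s :=
  IsNowhereDense.isMeagre (by rw [IsNowhereDense, hs.closure_eq, h])

/-- The image of a compact set on which the derivative of `f` vanishes is meagre. -/
theorem isMeagre_image_of_fderiv_eq_zero {E F : Type*} [NormedAddCommGroup E] [NormedSpace ℝ E]
    [FiniteDimensional ℝ E] [NormedAddCommGroup F] [NormedSpace ℝ F] [CompleteSpace F]
    [Nontrivial F] {f : E → F} {K : Set E} (hK : IsCompact K)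
    (hf : ∀ x ∈ K, ContDiffAt ℝ ∞ f x) (h0 : ∀ x ∈ K, fderiv ℝ f x = 0) :
    IsMeagre (f '' K) := by
  obtain ⟨u, hu⟩ := exists_ne (0 : F)
  obtain ⟨ℓ, hℓ⟩ := SeparatingDual.exists_eq_one (R := ℝ) hu
  have hsurj : Function.Surjective ℓ := fun t => ⟨t • u, by simp [hℓ]⟩
  have hcomp : ∀ x ∈ K, ContDiffAt ℝ ∞ (fun x => ℓ (f x)) x := fun x hx =>
    ℓ.contDiff.contDiffAt.comp x (hf x hx)
  have hnull : volume ((fun x => ℓ (f x)) '' K) = 0 := by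
    refine volume_image_eq_zero_of_fderiv_eq_zero _ E rfl _ K hcomp fun x hx => ?_
    have := (ℓ.hasFDerivAt.comp x ((hf x hx).differentiableAt (by simp)).hasFDerivAt).fderiv
    rw [h0 x hx, ContinuousLinearMap.comp_zero] at this
    exact this
  have hcl : IsClosed ((fun x => ℓ (f x)) '' K) :=
    (hK.image_of_continuousOn fun x hx => (hcomp x hx).continuousAt.continuousWithinAt).isClosed
  refine IsMeagre.mono (s := ℓ ⁻¹' ((fun x => ℓ (f x)) '' K)) ?_
    (IsClosed.isMeagre_of_interior_eq_empty (hcl.preimage ℓ.continuous) ?_)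
  · rintro _ ⟨x, hx, rfl⟩
    exact ⟨x, hx, rfl⟩
  · rw [← (ℓ.isOpenMap hsurj).preimage_interior_eq_interior_preimage ℓ.continuous,
      interior_eq_empty_iff_dense_compl.2, preimage_empty]
    exact Measure.dense_of_ae (μ := volume) (p := fun t => t ∉ (fun x => ℓ (f x)) '' K)
      (measure_eq_zero_iff_ae_notMem.1 hnull)

/-- **Sard's theorem**, in terms of Baire category: the image of a compact set of critical points
of a smooth map is meagre. -/
theorem isMeagre_image_of_not_surjective.{u, v} (n : ℕ) :
    ∀ (F : Type v) [NormedAddCommGroup F] [NormedSpace ℝ F] [FiniteDimensional ℝ F],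
      finrank ℝ F = n →
      ∀ (E : Type u) [NormedAddCommGroup E] [NormedSpace ℝ E] [FiniteDimensional ℝ E]
        (f : E → F) (K : Set E), IsCompact K → (∀ x ∈ K, ContDiffAt ℝ ∞ f x) →
        (∀ x ∈ K, ¬ Function.Surjective (fderiv ℝ f x)) → IsMeagre (f '' K) := by
  induction n with
  | zero =>
    intro F _ _ _ hF E _ _ _ f K hK hf hcrit
    have : Subsingleton F := finrank_zero_iff.1 hF
    have hKe : K = ∅ := eq_empty_of_forall_notMem fun x hx =>
      hcrit x hx fun y => ⟨0, Subsingleton.elim _ _⟩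
    rw [hKe, image_empty]
    exact IsMeagre.empty
  | succ n ih =>
    intro F _ _ _ hF E _ _ _ f K hK hf hcrit
    have : Nontrivial F := nontrivial_of_finrank_pos (R := ℝ) (by omega)
    have hfc : ∀ x ∈ K, ContinuousAt (fderiv ℝ f) x := fun x hx =>
      ((hf x hx).fderiv_right (m := 0) (by simp)).continuousAt
    set Z : Set E := K ∩ fderiv ℝ f ⁻¹' {0}
    have hZc : IsCompact Z := hK.of_isClosed_subset
      (ContinuousOn.preimage_isClosed_of_isClosed
        (fun x hx => (hfc x hx).continuousWithinAt) hK.isClosed isClosed_singleton)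
      inter_subset_left
    have hZm : IsMeagre (f '' Z) := isMeagre_image_of_fderiv_eq_zero hZc
      (fun x hx => hf x hx.1) fun x hx => hx.2
    rw [← inter_union_sdiff K (fderiv ℝ f ⁻¹' {0}), image_union]
    refine hZm.union (isMeagre_image_of_locally fun x₀ hx₀ => ?_)
    obtain ⟨hx₀K, hx₀⟩ := hx₀
    obtain ⟨v₀, hv₀⟩ : ∃ v, fderiv ℝ f x₀ v ≠ 0 := by
      by_contra! hcon
      exact hx₀ (ContinuousLinearMap.ext hcon)
    obtain ⟨ℓ, hℓ⟩ := SeparatingDual.exists_eq_one (R := ℝ) hv₀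
    set u := fderiv ℝ f x₀ v₀ with hu
    set w : E → ℝ := fun x => ℓ (f x) with hw
    have hwK : ∀ x ∈ K, ContDiffAt ℝ ∞ w x := fun x hx =>
      ℓ.contDiff.contDiffAt.comp x (hf x hx)
    have hwv : fderiv ℝ w x₀ v₀ = 1 := by
      have := (ℓ.hasFDerivAt.comp x₀
        ((hf x₀ hx₀K).differentiableAt (by simp)).hasFDerivAt).fderiv
      change fderiv ℝ (ℓ ∘ f) x₀ v₀ = 1
      rw [this]
      exact hℓ
    obtain ⟨h, hxh, hlin, hsm, hsymm⟩ := exists_openPartialHomeomorph_straighten (hwK x₀ hx₀K) hwv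
    set A := fderiv ℝ w x₀
    obtain ⟨V, hV, hVs, hVc⟩ := local_compact_nhds (h.open_source.mem_nhds hxh)
    refine ⟨V, mem_nhdsWithin_of_mem_nhds hV, ?_⟩
    set K₁ := K ∩ V
    have hK₁c : IsCompact K₁ := hK.inter hVc
    refine IsMeagre.mono (s := f '' K₁) (image_mono (inter_subset_inter_left _ sdiff_subset)) ?_
    have hfK₁ : IsClosed (f '' K₁) := (hK₁c.image_of_continuousOn fun x hx =>
      (hf x hx.1).continuousAt.continuousWithinAt).isClosed
    refine IsClosed.isMeagre_of_interior_eq_empty hfK₁ ?_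
    by_contra hne
    obtain ⟨y₀, hy₀⟩ := nonempty_iff_ne_empty.2 hne
    -- the slice through `y₀` parallel to `ker ℓ`
    set a : E := ℓ y₀ • v₀ with ha
    have hAa : A a = ℓ y₀ := by simp [ha, hwv]
    set p : F →L[ℝ] ℓ.ker :=
      (ContinuousLinearMap.id ℝ F - ℓ.smulRight u).codRestrict ℓ.ker (by
        intro y
        change ℓ (y - ℓ y • u) = 0
        simp [hℓ]) with hp
    have hpk : ∀ k : ℓ.ker, p k = k := by
      intro k
      have hk : ℓ (k : F) = 0 := k.2
      ext
      simp [hp, hk]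
    set g : A.ker → ℓ.ker := fun z => p (f (h.symm (a + z)) - y₀) with hg
    set K₂ : Set A.ker := (fun z : A.ker => a + (z : E)) ⁻¹' (h '' K₁)
    have himc : IsCompact (h '' K₁) := hK₁c.image_of_continuousOn fun x hx =>
      (hsm x (hVs hx.2) (hwK x hx.1)).continuousAt.continuousWithinAt
    have hK₂c : IsCompact K₂ := by
      refine Topology.IsClosedEmbedding.isCompact_preimage ?_ himc
      exact (Homeomorph.addLeft a).isClosedEmbedding.comp
        (ContinuousLinearMap.isClosed_ker A).isClosedEmbedding_subtypeVal
    have key : ∀ z ∈ K₂, ContDiffAt ℝ ∞ g z ∧ ¬ Function.Surjective (fderiv ℝ g z) := by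
      rintro z ⟨x, hxK₁, hxz⟩
      replace hxz : h x = a + (z : E) := hxz
      have hxs : x ∈ h.source := hVs hxK₁.2
      have hz : h.symm (a + z) = x := by rw [← hxz, h.left_inv hxs]
      have hzt : a + (z : E) ∈ h.target := by rw [← hxz]; exact h.map_source hxs
      have h1 : ContDiffAt ℝ ∞ h.symm (a + z) := by
        rw [← hxz]; exact hsymm x hxs (hwK x hxK₁.1)
      have h2 : ContDiffAt ℝ ∞ f (h.symm (a + z)) := by rw [hz]; exact hf x hxK₁.1
      have hcomp : ContDiffAt ℝ ∞ (fun e => f (h.symm e)) (a + z) := ContDiffAt.comp _ h2 h1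
      have hdcomp := (HasFDerivAt.comp (a + (z : E)) (h2.differentiableAt (by simp)).hasFDerivAt
        (h1.differentiableAt (by simp)).hasFDerivAt)
      set B := fderiv ℝ h.symm (a + (z : E))
      rw [hz] at hdcomp
      have hemb : ContDiff ℝ ∞ (fun z : A.ker => a + (z : E)) :=
        contDiff_const.add A.ker.subtypeL.contDiff
      have hembd : HasFDerivAt (fun z : A.ker => a + (z : E)) A.ker.subtypeL z :=
        A.ker.subtypeL.hasFDerivAt.const_add a
      have hgs : ContDiffAt ℝ ∞ g z := by
        refine p.contDiff.contDiffAt.comp z ?_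
        exact (ContDiffAt.comp z hcomp hemb.contDiffAt).sub contDiffAt_const
      have hgd : fderiv ℝ g z = p.comp (((fderiv ℝ f x).comp B).comp A.ker.subtypeL) := by
        refine HasFDerivAt.fderiv ?_
        exact p.hasFDerivAt.comp z
          ((HasFDerivAt.comp (g := f ∘ h.symm) z hdcomp hembd).sub_const y₀)
      have hLB : ∀ e, ℓ (fderiv ℝ f x (B e)) = A e := by
        have e1 : HasFDerivAt (fun e => ℓ (f (h.symm e))) (ℓ.comp ((fderiv ℝ f x).comp B))
            (a + (z : E)) := ℓ.hasFDerivAt.comp _ hdcomp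
        have e2 : HasFDerivAt (fun e => ℓ (f (h.symm e))) A (a + (z : E)) := by
          refine A.hasFDerivAt.congr_of_eventuallyEq ?_
          filter_upwards [h.open_target.mem_nhds hzt] with e he
          rw [← h.right_inv he, hlin, h.right_inv he]
        intro e
        exact DFunLike.congr_fun (e1.unique e2) e
      refine ⟨hgs, fun hs => hcrit x hxK₁.1 fun y => ?_⟩
      have hker : y - fderiv ℝ f x (B (ℓ y • v₀)) ∈ ℓ.ker := by
        change ℓ (y - fderiv ℝ f x (B (ℓ y • v₀))) = 0
        rw [map_sub, hLB, map_smul, hwv]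
        simp
      obtain ⟨k, hk⟩ := hs ⟨_, hker⟩
      have hk' : fderiv ℝ f x (B (k : E)) ∈ ℓ.ker := by
        change ℓ (fderiv ℝ f x (B (k : E))) = 0
        rw [hLB]
        exact k.2
      rw [hgd] at hk
      have hk2 : p (fderiv ℝ f x (B (k : E))) = ⟨_, hker⟩ := hk
      have hk3 := hpk ⟨_, hk'⟩
      have hk4 : fderiv ℝ f x (B (k : E)) = y - fderiv ℝ f x (B (ℓ y • v₀)) :=
        congrArg Subtype.val (hk3.symm.trans hk2)
      refine ⟨B (ℓ y • v₀) + B k, ?_⟩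
      rw [map_add, hk4]
      abel
    have hmeagre : IsMeagre (g '' K₂) :=
      ih ℓ.ker (by have := finrank_ker_of_apply_eq_one hℓ; omega) A.ker g K₂ hK₂c
        (fun z hz => (key z hz).1) fun z hz => (key z hz).2
    have hopen : IsOpen ((fun k : ℓ.ker => y₀ + (k : F)) ⁻¹' interior (f '' K₁)) :=
      isOpen_interior.preimage (by fun_prop)
    refine not_isMeagre_of_isOpen hopen ⟨0, by simpa using hy₀⟩ (hmeagre.mono ?_)
    intro k hk
    obtain ⟨x, hx, hxk⟩ := interior_subset (show y₀ + (k : F) ∈ interior (f '' K₁) from hk)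
    have hk0 : ℓ (k : F) = 0 := k.2
    have hmem : h x - a ∈ A.ker := by
      change A (h x - a) = 0
      rw [map_sub, hlin, hAa, hw]
      simp [hxk, hk0]
    refine ⟨⟨h x - a, hmem⟩, ⟨x, hx, by simp⟩, ?_⟩
    simp only [hg, add_sub_cancel, h.left_inv (hVs hx.2), hxk, add_sub_cancel_left]
    exact hpk k

theorem isOpen_setOf_surjective {E F : Type*} [NormedAddCommGroup E] [NormedSpace ℝ E]
    [NormedAddCommGroup F] [NormedSpace ℝ F] [FiniteDimensional ℝ F] :
    IsOpen {A : E →L[ℝ] F | Function.Surjective A} := by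
  refine isOpen_iff_mem_nhds.2 fun A hA => ?_
  obtain ⟨R, hR⟩ := LinearMap.exists_rightInverse_of_surjective (A : E →ₗ[ℝ] F)
    (LinearMap.range_eq_top.2 hA)
  set R' : F →L[ℝ] E := LinearMap.toContinuousLinearMap R
  have hR' : A.comp R' = (ContinuousLinearEquiv.refl ℝ F : F →L[ℝ] F) := by
    ext y
    exact DFunLike.congr_fun hR y
  have hc : ContinuousAt (fun B : E →L[ℝ] F => B.comp R') A := by fun_prop
  have hnhds := ContinuousLinearEquiv.nhds (𝕜 := ℝ) (ContinuousLinearEquiv.refl ℝ F)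
  rw [← hR'] at hnhds
  filter_upwards [hc hnhds] with B ⟨e, he⟩ y
  replace he : (e : F →L[ℝ] F) = B.comp R' := he
  exact ⟨R' (e.symm y), by
    rw [← ContinuousLinearMap.comp_apply, ← he]
    simp⟩

/-- **Sard's theorem**: almost every value of a smooth map, in the sense of Baire category, is
regular. -/
theorem setOf_regularValue_mem_residual {E F : Type*} [NormedAddCommGroup E] [NormedSpace ℝ E]
    [FiniteDimensional ℝ E] [NormedAddCommGroup F] [NormedSpace ℝ F] [FiniteDimensional ℝ F]
    {f : E → F} (hf : ContDiff ℝ ∞ f) :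
    {b | ∀ x, f x = b → Function.Surjective (fderiv ℝ f x)} ∈ residual F := by
  have hcl : IsClosed {x | ¬ Function.Surjective (fderiv ℝ f x)} := by
    rw [← isOpen_compl_iff]
    have : {x | ¬ Function.Surjective (fderiv ℝ f x)}ᶜ =
        fderiv ℝ f ⁻¹' {A : E →L[ℝ] F | Function.Surjective A} := by ext; simp
    rw [this]
    exact isOpen_setOf_surjective.preimage (hf.continuous_fderiv (by simp))
  have hm : IsMeagre (⋃ i, f '' (compactCovering E i ∩
      {x | ¬ Function.Surjective (fderiv ℝ f x)})) :=
    isMeagre_iUnion fun i => isMeagre_image_of_not_surjective _ F rfl E f _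
      ((isCompact_compactCovering E i).inter_right hcl) (fun x _ => hf.contDiffAt) fun x hx => hx.2
  refine Filter.mem_of_superset hm fun b hb x hx => ?_
  by_contra hcon
  obtain ⟨i, hi⟩ := exists_mem_compactCovering x
  exact hb (mem_iUnion.2 ⟨i, x, ⟨hi, hcon⟩, hx⟩)

end Sard

section Symmetric

open ContDiff

/-- The subspace of symmetric matrices. -/
def symmSubmodule (n : ℕ) : Submodule ℝ (Mat n) where
  carrier := {B | B.IsSymm}
  add_mem' := fun ha hb => ha.add hb
  zero_mem' := Matrix.transpose_zero
  smul_mem' := fun c _ ha => ha.smul c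

/-- The projection of a matrix onto its symmetric part. -/
noncomputable def symmPart (n : ℕ) : Mat n →ₗ[ℝ] symmSubmodule n where
  toFun M := ⟨(2⁻¹ : ℝ) • (M + Mᵀ), (Matrix.isSymm_add_transpose_self M).smul _⟩
  map_add' M N := by
    ext1
    simp only [Matrix.transpose_add, Submodule.coe_add, ← smul_add]
    congr 1
    abel
  map_smul' c M := by
    ext1
    simp only [Matrix.transpose_smul, ← smul_add, RingHom.id_apply, Submodule.coe_smul]
    rw [smul_comm]

theorem symmPart_coe_of_isSymm {n : ℕ} {M : Mat n} (h : M.IsSymm) : (symmPart n M : Mat n) = M := by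
  change (2⁻¹ : ℝ) • (M + Mᵀ) = M
  rw [h.eq, ← two_smul ℝ M, smul_smul]
  norm_num

/-- The bilinear map `(R, S) ↦ R * Sᵀ`. -/
noncomputable def mulTransposeBilin (n : ℕ) : Mat n →L[ℝ] Mat n →L[ℝ] Mat n :=
  LinearMap.mkContinuous₂
    (LinearMap.mk₂ ℝ (fun R S : Mat n => R * Sᵀ) (fun _ _ _ => Matrix.add_mul _ _ _)
      (fun _ _ _ => Matrix.smul_mul _ _ _)
      (fun _ _ _ => by rw [Matrix.transpose_add, Matrix.mul_add])
      (fun _ _ _ => by rw [Matrix.transpose_smul, Matrix.mul_smul]))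
    1 (fun R S => by
      rw [one_mul]
      exact (Matrix.frobenius_norm_mul R Sᵀ).trans_eq (by rw [Matrix.frobenius_norm_transpose]))

/-- For generic symmetric `b`, the map `(x, R) ↦ R * Rᵀ - g x` has `b` as a regular value. -/
theorem setOf_forall_exists_mul_transpose_mem_residual {m n : ℕ} {g : Em m → Mat n}
    (hg : ContDiff ℝ ∞ g) (hgs : ∀ x, (g x).IsSymm) :
    {b : symmSubmodule n | ∀ (x : Em m) (R : Mat n), g x + b = R * Rᵀ →
      ∀ C : Mat n, C.IsSymm → ∃ (v : Em m) (H : Mat n),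
        C = fderiv ℝ g x v + (H * Rᵀ + R * Hᵀ)} ∈ residual (symmSubmodule n) := by
  set T := mulTransposeBilin n
  set S : Mat n →L[ℝ] symmSubmodule n := LinearMap.toContinuousLinearMap (symmPart n)
  set Ψ : Em m × Mat n → Mat n := fun z => T z.2 z.2 - g z.1
  have hΨs : ∀ z, (Ψ z).IsSymm := fun z =>
    (Matrix.isSymm_mul_transpose_self z.2).sub (hgs z.1)
  have hTs : ContDiff ℝ ∞ fun z : Em m × Mat n => T z.2 z.2 :=
    T.isBoundedBilinearMap.contDiff.comp (contDiff_snd.prodMk contDiff_snd)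
  have hΨd : ContDiff ℝ ∞ Ψ := hTs.sub (hg.comp contDiff_fst)
  have hΦd : ContDiff ℝ ∞ (fun z => S (Ψ z)) := S.contDiff.comp hΨd
  refine Filter.mem_of_superset (setOf_regularValue_mem_residual hΦd) ?_
  intro b hb x R hR C hC
  have hval : S (Ψ (x, R)) = b := by
    ext1
    change (symmPart n (Ψ (x, R)) : Mat n) = b
    rw [symmPart_coe_of_isSymm (hΨs _)]
    change R * Rᵀ - g x = b
    rw [← hR]
    abel
  obtain ⟨⟨v, H⟩, hvH⟩ := hb (x, R) hval ⟨C, hC⟩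
  have d1 : HasFDerivAt (fun z => S (Ψ z)) (S.comp (fderiv ℝ Ψ (x, R))) (x, R) :=
    S.hasFDerivAt.comp _ ((hΨd.differentiable (by simp)) _).hasFDerivAt
  have d2 : HasFDerivAt Ψ ((symmSubmodule n).subtypeL.comp (S.comp (fderiv ℝ Ψ (x, R))))
      (x, R) := by
    refine ((symmSubmodule n).subtypeL.hasFDerivAt.comp _ d1).congr_of_eventuallyEq ?_
    exact Filter.Eventually.of_forall fun z => (symmPart_coe_of_isSymm (hΨs z)).symm
  have d3 : HasFDerivAt Ψ _ (x, R) :=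
    (T.hasFDerivAt_of_bilinear (hasFDerivAt_snd (p := (x, R))) (hasFDerivAt_snd (p := (x, R)))).sub
      (HasFDerivAt.comp (x, R) (g := g) ((hg.differentiable (by simp)) x).hasFDerivAt
        (hasFDerivAt_fst (p := (x, R))))
  have h4 := DFunLike.congr_fun (d2.unique d3) (v, H)
  replace hvH := (DFunLike.congr_fun d1.fderiv (v, H)).symm.trans hvH
  have h5 : ((symmSubmodule n).subtypeL.comp (S.comp (fderiv ℝ Ψ (x, R)))) (v, H) = C :=
    congrArg Subtype.val hvH
  rw [h5] at h4
  refine ⟨-v, H, h4.trans ?_⟩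
  rw [map_neg]
  change (R * Hᵀ + H * Rᵀ) - fderiv ℝ g x v = _
  abel

end Symmetric

open scoped MatrixOrder in
/-- A positive semidefinite real matrix is a Gram matrix. -/
theorem exists_transpose_mul_self_of_posSemidef {n : ℕ} {A : Matrix (Fin n) (Fin n) ℝ}
    (hA : A.PosSemidef) : ∃ S : Matrix (Fin n) (Fin n) ℝ, A = Sᵀ * S := by
  obtain ⟨S, hS⟩ := CStarAlgebra.nonneg_iff_eq_star_mul_self.mp hA.nonneg
  exact ⟨S, by rw [hS, Matrix.star_eq_conjTranspose, Matrix.conjTranspose_eq_transpose_of_trivial]⟩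

/-- If `R * Rᵀ` and `-y` are complementary positive semidefinite matrices, then `Rᵀ` annihilates the
eigenvectors of `R * Rᵀ + y` with nonpositive eigenvalue. -/
theorem transpose_mul_apply_eq_zero {n : ℕ} {R y P : Mat n} {lam : Fin n → ℝ}
    (hy : (-y).PosSemidef) (hRy : minner (R * Rᵀ) y = 0)
    (hP : IsEigDecomp (R * Rᵀ + y) P lam) {i : Fin n} (hi : lam i ≤ 0) (k : Fin n) :
    (Rᵀ * P) k i = 0 := by
  obtain ⟨⟨hP1, hP2⟩, -, hdec⟩ := hP
  obtain ⟨S, hS⟩ := exists_transpose_mul_self_of_posSemidef hy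
  have hyS : y = -(Sᵀ * S) := by rw [← hS, neg_neg]
  have hSR : S * R = 0 := by
    rw [← Matrix.trace_conjTranspose_mul_self_eq_zero_iff,
      Matrix.conjTranspose_eq_transpose_of_trivial]
    rw [minner, hyS, Matrix.mul_neg, Matrix.trace_neg, neg_eq_zero] at hRy
    rw [← hRy, Matrix.transpose_mul, Matrix.transpose_mul, Matrix.transpose_transpose,
      Matrix.mul_assoc R, Matrix.trace_mul_comm R]
    simp only [Matrix.mul_assoc]
  have hRy0 : R * Rᵀ * y = 0 := by
    have : Rᵀ * Sᵀ = 0 := by rw [← Matrix.transpose_mul, hSR, Matrix.transpose_zero]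
    rw [hyS, Matrix.mul_neg, Matrix.mul_assoc, ← Matrix.mul_assoc Rᵀ, this]
    simp
  set W := Rᵀ * P with hW
  have hM : Wᵀ * W * (Wᵀ * W) = Wᵀ * W * Matrix.diagonal lam := by
    have e1 : Wᵀ * W = Pᵀ * (R * Rᵀ) * P := by
      rw [hW, Matrix.transpose_mul, Matrix.transpose_transpose]
      simp only [Matrix.mul_assoc]
    have e2 : R * Rᵀ * (R * Rᵀ) = R * Rᵀ * (P * Matrix.diagonal lam * Pᵀ) := by
      rw [← hdec, Matrix.mul_add, hRy0, add_zero]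
    calc Wᵀ * W * (Wᵀ * W) = Pᵀ * (R * Rᵀ) * (P * Pᵀ) * (R * Rᵀ) * P := by
          rw [e1]; simp only [Matrix.mul_assoc]
      _ = Pᵀ * (R * Rᵀ * (R * Rᵀ)) * P := by rw [hP1]; simp only [Matrix.mul_assoc, Matrix.one_mul]
      _ = Pᵀ * (R * Rᵀ) * P * Matrix.diagonal lam * (Pᵀ * P) := by
          rw [e2]; simp only [Matrix.mul_assoc]
      _ = Wᵀ * W * Matrix.diagonal lam := by rw [hP2, Matrix.mul_one, e1]
  have hsymm : ∀ k, (Wᵀ * W) k i = (Wᵀ * W) i k := fun k =>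
    congrFun (congrFun (Matrix.isSymm_transpose_mul_self W) i) k
  have hii : (Wᵀ * W) i i = ∑ k, W k i ^ 2 := by
    rw [Matrix.mul_apply]
    exact Finset.sum_congr rfl fun k _ => by rw [Matrix.transpose_apply, sq]
  have hdiag := congrFun (congrFun hM i) i
  rw [Matrix.mul_diagonal, Matrix.mul_apply] at hdiag
  have hnn : 0 ≤ (Wᵀ * W) i i := by rw [hii]; positivity
  have hsum : ∑ k, (Wᵀ * W) i k ^ 2 = 0 := by
    refine le_antisymm ?_ (by positivity)
    calc ∑ k, (Wᵀ * W) i k ^ 2 = ∑ k, (Wᵀ * W) i k * (Wᵀ * W) k i :=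
          Finset.sum_congr rfl fun k _ => by rw [hsymm, sq]
      _ = (Wᵀ * W) i i * lam i := hdiag
      _ ≤ 0 := mul_nonpos_of_nonneg_of_nonpos hnn hi
  have h0 : (Wᵀ * W) i i = 0 := by
    have := (Finset.sum_eq_zero_iff_of_nonneg fun k _ => sq_nonneg _).1 hsum i (Finset.mem_univ i)
    exact pow_eq_zero_iff (two_ne_zero) |>.1 this
  rw [hii] at h0
  have := (Finset.sum_eq_zero_iff_of_nonneg fun k _ => sq_nonneg _).1 h0 k (Finset.mem_univ k)
  exact pow_eq_zero_iff (two_ne_zero) |>.1 this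

/-- Genericity of the W-SRCQ: for a `C^∞` map `g : ℝᵐ → Sⁿ`, the set of
symmetric perturbations `b` such that the W-SRCQ for `g_b = g + b` holds at every `(x,y)`
with `g_b(x) ⪰ 0`, `y ⪯ 0` and `⟨g_b(x), y⟩ = 0`, is residual in `Sⁿ`. -/
theorem WSRCQ_generic {m n : ℕ}
    (g : Em m → Mat n)
    (hg : ContDiff ℝ (⊤ : ℕ∞) g) (hgs : ∀ x, (g x).IsSymm) :
    {b : {B : Mat n // B.IsSymm} |
        ∀ (x : Em m) (y : Mat n),
          (g x + b.1).PosSemidef → (-y).PosSemidef → minner (g x + b.1) y = 0 →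
            WSRCQ (fun u => g u + b.1) (x, y)}
      ∈ residual {B : Mat n // B.IsSymm} := by
  refine Filter.mem_of_superset (setOf_forall_exists_mul_transpose_mem_residual hg hgs) ?_
  intro b hb x y hA hy hAy P lam hdec C hC
  obtain ⟨S, hS⟩ := exists_transpose_mul_self_of_posSemidef hA
  obtain ⟨R, rfl⟩ : ∃ R : Mat n, Rᵀ = S := ⟨Sᵀ, Matrix.transpose_transpose S⟩
  rw [Matrix.transpose_transpose] at hS
  obtain ⟨v, H, hvH⟩ := hb x R hS C hC
  replace hdec : IsEigDecomp (R * Rᵀ + y) P lam := by rw [← hS]; exact hdec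
  have hW := fun i (hi : lam i ≤ 0) =>
    transpose_mul_apply_eq_zero hy (by rw [← hS]; exact hAy) hdec hi
  obtain ⟨⟨hP1, -⟩, -, -⟩ := hdec
  have hB : ∀ i j, lam i ≤ 0 → lam j ≤ 0 → (Pᵀ * (H * Rᵀ + R * Hᵀ) * P) i j = 0 := by
    intro i j hi hj
    have e : Pᵀ * (H * Rᵀ + R * Hᵀ) * P = Pᵀ * H * (Rᵀ * P) + (Rᵀ * P)ᵀ * (Hᵀ * P) := by
      rw [Matrix.transpose_mul, Matrix.transpose_transpose, Matrix.mul_add, Matrix.add_mul]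
      simp only [Matrix.mul_assoc]
    rw [e, Matrix.add_apply, Matrix.mul_apply, Matrix.mul_apply]
    simp [hW i hi, hW j hj, -Matrix.transpose_mul]
  refine ⟨v, Pᵀ * (H * Rᵀ + R * Hᵀ) * P, ?_, fun i j hi hj => hB i j hi.le hj.le,
    fun i j hi hj => hB i j hi.le hj.le, ?_⟩
  · rw [Matrix.IsSymm]
    simp only [Matrix.transpose_mul, Matrix.transpose_add, Matrix.transpose_transpose]
    rw [add_comm, Matrix.mul_assoc]
  · have e : P * (Pᵀ * (H * Rᵀ + R * Hᵀ) * P) * Pᵀ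
        = (P * Pᵀ) * (H * Rᵀ + R * Hᵀ) * (P * Pᵀ) := by simp only [Matrix.mul_assoc]
    have hd : HasFDerivAt (fun u => g u + b.1) (fderiv ℝ g x) x :=
      ((hg.differentiable (by simp)) x).hasFDerivAt.add_const b.1
    rw [e, hP1, Matrix.one_mul, Matrix.mul_one]
    exact hvH.trans (congrArg (fun D : Em m →L[ℝ] Mat n => D v + (H * Rᵀ + R * Hᵀ)) hd.fderiv.symm)
end

section
/- Let x̄ ∈ ℝ^m be a local minimizer of f over the feasible set {x ∈ ℝ^m : g(x) is positive semidefinite}, assume the Robinson constraint qualification holds at x̄, namely g'(x̄)[ℝ^m] + {H ∈ S^n : (P₀^T H P₀)_{β₀β₀} is positive semidefinite} = S^n, where P₀ is any orthogonal matrix with g(x̄) = P₀·Diag(λ(g(x̄)))·P₀^T (eigenvalues nonincreasing) and β₀ is the index set of zero eigenvalues of g(x̄), and let ȳ ∈ S^n be such that z̄ := (x̄,ȳ) is a KKT pair (F(z̄) = 0). Then the following are equivalent: (a) the S-SOSC and the constraint nondegeneracy hold at z̄; (b) there exists an open neighborhood U of z̄ in ℝ^m × S^n such that the W-SOC holds uniformly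 on U and the W-SRCQ holds at every z ∈ U. -/
open scoped Classical RealInnerProductSpace
open Matrix Set

section Smoothness

variable {E F : Type*} [NormedAddCommGroup E] [NormedSpace ℝ E]
  [NormedAddCommGroup F] [NormedSpace ℝ F]

theorem continuous_fderiv_uncurry {h : E → F} (hh : ContDiff ℝ 2 h) :
    Continuous fun p : E × E => fderiv ℝ h p.1 p.2 :=
  ((hh.continuous_fderiv (by norm_num)).comp continuous_fst).clm_apply continuous_snd

theorem contDiff_fderiv_of_two {h : E → F} (hh : ContDiff ℝ 2 h) :
    ContDiff ℝ 1 (fderiv ℝ h) :=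
  hh.fderiv_right (by norm_num)

/-- The second derivative of `h` at `x` as a quadratic form. -/
noncomputable def secondDeriv (h : E → F) (x v : E) : F := fderiv ℝ (fderiv ℝ h) x v v

theorem continuous_secondDeriv {h : E → F} (hh : ContDiff ℝ 2 h) :
    Continuous fun p : E × E => secondDeriv h p.1 p.2 :=
  ((((contDiff_fderiv_of_two hh).continuous_fderiv one_ne_zero).comp continuous_fst).clm_apply
    continuous_snd).clm_apply continuous_snd

theorem secondDeriv_add_sum {ι : Type*} (s : Finset ι) {f : E → F} {h : ι → E → F} (a : ι → ℝ)
    (hf : ContDiff ℝ 2 f) (hh : ∀ k, ContDiff ℝ 2 (h k)) (x v : E) :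
    secondDeriv (fun w => f w + ∑ k ∈ s, a k • h k w) x v =
      secondDeriv f x v + ∑ k ∈ s, a k • secondDeriv (h k) x v := by
  have hfd : Differentiable ℝ f := hf.differentiable (by norm_num)
  have hhd : ∀ k, Differentiable ℝ (h k) := fun k => (hh k).differentiable (by norm_num)
  have hfd2 : Differentiable ℝ (fderiv ℝ f) :=
    (contDiff_fderiv_of_two hf).differentiable one_ne_zero
  have hhd2 : ∀ k, Differentiable ℝ (fderiv ℝ (h k)) := fun k =>
    (contDiff_fderiv_of_two (hh k)).differentiable one_ne_zero
  have h1 : fderiv ℝ (fun w => f w + ∑ k ∈ s, a k • h k w) =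
      fun w => fderiv ℝ f w + ∑ k ∈ s, a k • fderiv ℝ (h k) w := by
    funext w
    exact ((hfd w).hasFDerivAt.add
      (HasFDerivAt.fun_sum fun k _ => (hhd k w).hasFDerivAt.const_smul (a k))).fderiv
  have h2 : fderiv ℝ (fun w => fderiv ℝ f w + ∑ k ∈ s, a k • fderiv ℝ (h k) w) x =
      fderiv ℝ (fderiv ℝ f) x + ∑ k ∈ s, a k • fderiv ℝ (fderiv ℝ (h k)) x :=
    ((hfd2 x).hasFDerivAt.add
      (HasFDerivAt.fun_sum fun k _ => (hhd2 k x).hasFDerivAt.const_smul (a k))).fderiv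
  simp [secondDeriv, h1, h2]

end Smoothness

theorem inner_fderiv_gradient {E : Type*} [NormedAddCommGroup E] [InnerProductSpace ℝ E]
    [CompleteSpace E] {h : E → ℝ} (hh : ContDiff ℝ 2 h) (x v : E) :
    ⟪v, fderiv ℝ (fun u => gradient h u) x v⟫ = secondDeriv h x v := by
  have hd : DifferentiableAt ℝ (fderiv ℝ h) x :=
    (contDiff_fderiv_of_two hh).differentiable one_ne_zero x
  have h1 : fderiv ℝ (fun u => gradient h u) x v =
      (InnerProductSpace.toDual ℝ E).symm (fderiv ℝ (fderiv ℝ h) x v) := by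
    have := ((InnerProductSpace.toDual ℝ E).symm.toContinuousLinearEquiv.toContinuousLinearMap
      |>.restrictScalars ℝ).hasFDerivAt.comp x hd.hasFDerivAt
    have h2 := congrArg (fun T => T v) this.fderiv
    exact h2
  rw [h1, real_inner_comm, InnerProductSpace.toDual_symm_apply]
  rfl

/-- The `(i, j)` entry as a continuous linear functional for the Frobenius norm. -/
noncomputable def entryCLM {n : ℕ} (i j : Fin n) : Mat n →L[ℝ] ℝ :=
  LinearMap.toContinuousLinearMap (Matrix.entryLinearMap ℝ ℝ i j)

theorem contDiff_entry {m n : ℕ} {g : Em m → Mat n} (hg : ContDiff ℝ 2 g) (i j : Fin n) :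
    ContDiff ℝ 2 fun x => g x i j :=
  (entryCLM i j).contDiff.comp hg

theorem minner_eq_sum {n : ℕ} (A B : Mat n) :
    minner A B = ∑ k : Fin n × Fin n, A k.1 k.2 • B k.1 k.2 := by
  simp only [minner, Matrix.trace, Matrix.diag, Matrix.mul_apply, Matrix.transpose_apply,
    Fintype.sum_prod_type, smul_eq_mul]
  exact Finset.sum_comm

theorem inner_hessL {m n : ℕ} {f : Em m → ℝ} {g : Em m → Mat n}
    (hf : ContDiff ℝ 2 f) (hg : ContDiff ℝ 2 g) (x : Em m) (y : Mat n) (v : Em m) :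
    ⟪v, hessL f g x y v⟫ = secondDeriv f x v +
      ∑ k : Fin n × Fin n, y k.1 k.2 • secondDeriv (fun w => g w k.1 k.2) x v := by
  have hL : (fun w => Lfun f g w y) =
      fun w => f w + ∑ k : Fin n × Fin n, y k.1 k.2 • g w k.1 k.2 := by
    funext w
    rw [Lfun, minner_eq_sum]
  have hC : ContDiff ℝ 2 fun w => Lfun f g w y := by
    rw [hL]
    exact hf.add (ContDiff.sum fun k _ => (contDiff_entry hg k.1 k.2).const_smul (y k.1 k.2))
  rw [hessL, inner_fderiv_gradient hC, hL]
  exact secondDeriv_add_sum Finset.univ (fun k : Fin n × Fin n => y k.1 k.2) hf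
    (fun k => contDiff_entry hg k.1 k.2) x v

theorem continuous_inner_hessL {m n : ℕ} {f : Em m → ℝ} {g : Em m → Mat n}
    (hf : ContDiff ℝ 2 f) (hg : ContDiff ℝ 2 g) {X : Type*} [TopologicalSpace X]
    {x v : X → Em m} {y : X → Mat n} (hx : Continuous x) (hy : Continuous y)
    (hv : Continuous v) : Continuous fun p => ⟪v p, hessL f g (x p) (y p) (v p)⟫ := by
  simp only [inner_hessL hf hg, smul_eq_mul]
  exact ((continuous_secondDeriv hf).comp (hx.prodMk hv)).add
    (continuous_finsetSum _ fun k _ => (hy.matrix_elem k.1 k.2).mul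
      ((continuous_secondDeriv (contDiff_entry hg k.1 k.2)).comp (hx.prodMk hv)))

theorem continuous_fderiv_mat {m n : ℕ} {g : Em m → Mat n} (hg : ContDiff ℝ 2 g) :
    Continuous fun p : Em m × Em m => fderiv ℝ g p.1 p.2 :=
  continuous_fderiv_uncurry hg

theorem fderiv_isSymm {m n : ℕ} {g : Em m → Mat n} (hg : ContDiff ℝ 2 g)
    (hgs : ∀ x, (g x).IsSymm) (x v : Em m) : (fderiv ℝ g x v).IsSymm := by
  have hd : HasFDerivAt g (fderiv ℝ g x) x :=
    (hg.differentiable (by norm_num) x).hasFDerivAt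
  have key : ∀ i j, HasFDerivAt (fun w => g w i j) ((entryCLM i j).comp (fderiv ℝ g x)) x :=
    fun i j => (entryCLM i j).hasFDerivAt.comp x hd
  ext i j
  have h1 := key j i
  have h2 : (fun w => g w j i) = fun w => g w i j := by
    funext w
    exact (hgs w).apply i j
  rw [h2] at h1
  exact congrArg (fun T => T v) (h1.unique (key i j))

theorem IsOrthoMat.abs_entry_le_one {n : ℕ} {P : Mat n} (hP : IsOrthoMat P) (i j : Fin n) :
    |P i j| ≤ 1 := by
  have h := congrFun (congrFun hP.1 i) i
  rw [Matrix.mul_apply, Matrix.one_apply_eq] at h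
  simp only [Matrix.transpose_apply] at h
  have h2 : P i j * P i j ≤ ∑ k, P i k * P i k :=
    Finset.single_le_sum (f := fun k => P i k * P i k)
      (fun k _ => mul_self_nonneg _) (Finset.mem_univ j)
  rw [abs_le]
  constructor <;> nlinarith

theorem isCompact_isOrthoMat (n : ℕ) : IsCompact {P : Mat n | IsOrthoMat P} := by
  have hK : IsCompact (X := Mat n) (Set.pi univ fun _ : Fin n => Set.pi univ fun _ : Fin n =>
      Icc (-1 : ℝ) 1) :=
    isCompact_univ_pi fun _ => isCompact_univ_pi fun _ => isCompact_Icc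
  refine hK.of_isClosed_subset ?_ fun P hP i _ j _ => abs_le.mp (hP.abs_entry_le_one i j)
  have h1 : Continuous fun P : Mat n => P * Pᵀ := by fun_prop
  have h2 : Continuous fun P : Mat n => Pᵀ * P := by fun_prop
  exact (isClosed_eq h1 continuous_const).inter (isClosed_eq h2 continuous_const)

theorem IsOrthoMat.conj_cancel {n : ℕ} {P : Mat n} (hP : IsOrthoMat P) (B : Mat n) :
    Pᵀ * (P * B * Pᵀ) * P = B := by
  calc Pᵀ * (P * B * Pᵀ) * P = (Pᵀ * P) * B * (Pᵀ * P) := by simp only [Matrix.mul_assoc]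
    _ = B := by rw [hP.2, Matrix.one_mul, Matrix.mul_one]

theorem IsOrthoMat.conj_cancel' {n : ℕ} {P : Mat n} (hP : IsOrthoMat P) (B : Mat n) :
    P * (Pᵀ * B * P) * Pᵀ = B := by
  calc P * (Pᵀ * B * P) * Pᵀ = (P * Pᵀ) * B * (P * Pᵀ) := by simp only [Matrix.mul_assoc]
    _ = B := by rw [hP.1, Matrix.one_mul, Matrix.mul_one]

theorem isSymm_conj {n : ℕ} {A : Mat n} (hA : A.IsSymm) (P : Mat n) : (P * A * Pᵀ).IsSymm := by
  rw [Matrix.IsSymm, Matrix.transpose_mul, Matrix.transpose_mul, Matrix.transpose_transpose,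
    hA.eq, Matrix.mul_assoc]

theorem isSymm_conj' {n : ℕ} {A : Mat n} (hA : A.IsSymm) (P : Mat n) : (Pᵀ * A * P).IsSymm := by
  simpa using isSymm_conj hA Pᵀ

/-- The diagonal of `Pᵀ G(z) P`: the eigenvalues of `G(z)` when `P` diagonalizes `G(z)`. -/
noncomputable def diagVals {m n : ℕ} (g : Em m → Mat n) (z : Em m × Mat n) (P : Mat n) (i : Fin n) :
    ℝ :=
  (Pᵀ * Gmap g z * P) i i

theorem IsEigDecomp.eq_diagVals {m n : ℕ} {g : Em m → Mat n} {z : Em m × Mat n} {P : Mat n}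
    {lam : Fin n → ℝ} (h : IsEigDecomp (Gmap g z) P lam) : lam = diagVals g z P := by
  funext i
  rw [diagVals, h.2.2, h.1.conj_cancel, Matrix.diagonal_apply_eq]

theorem continuous_Gmap {m n : ℕ} {g : Em m → Mat n} (hg : ContDiff ℝ 2 g) :
    Continuous (Gmap g) := by
  have hc : Continuous g := hg.continuous
  unfold Gmap
  fun_prop

theorem continuous_diagVals {m n : ℕ} {g : Em m → Mat n} (hg : ContDiff ℝ 2 g) (i : Fin n) :
    Continuous fun p : (Em m × Mat n) × Mat n => diagVals g p.1 p.2 i := by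
  have hc : Continuous fun p : (Em m × Mat n) × Mat n => p.2ᵀ * Gmap g p.1 * p.2 :=
    (continuous_snd.matrix_transpose.matrix_mul
      ((continuous_Gmap hg).comp continuous_fst)).matrix_mul continuous_snd
  exact hc.matrix_elem i i

theorem isClosed_isEigDecomp {m n : ℕ} {g : Em m → Mat n} (hg : ContDiff ℝ 2 g) :
    IsClosed {p : (Em m × Mat n) × Mat n | IsEigDecomp (Gmap g p.1) p.2 (diagVals g p.1 p.2)} := by
  have hl := continuous_diagVals hg
  have hG : Continuous fun p : (Em m × Mat n) × Mat n => Gmap g p.1 :=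
    (continuous_Gmap hg).comp continuous_fst
  have hd : Continuous fun p : (Em m × Mat n) × Mat n =>
      p.2 * Matrix.diagonal (diagVals g p.1 p.2) * p.2ᵀ :=
    (continuous_snd.matrix_mul (continuous_pi hl).matrix_diagonal).matrix_mul
      continuous_snd.matrix_transpose
  have h1 : Continuous fun p : (Em m × Mat n) × Mat n => p.2 * p.2ᵀ := by fun_prop
  have h2 : Continuous fun p : (Em m × Mat n) × Mat n => p.2ᵀ * p.2 := by fun_prop
  refine ((isClosed_eq h1 continuous_const).inter (isClosed_eq h2 continuous_const)).inter
    (IsClosed.inter ?_ (isClosed_eq hG hd))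
  have hA : {p : (Em m × Mat n) × Mat n | Antitone (diagVals g p.1 p.2)} =
      ⋂ (i : Fin n) (j : Fin n) (_ : i ≤ j),
        {p | diagVals g p.1 p.2 j ≤ diagVals g p.1 p.2 i} := by
    ext p
    simp only [Set.mem_ofPred_eq, Set.mem_iInter]
    exact ⟨fun h i j hij => h hij, fun h i j hij => h i j hij⟩
  have hcl : IsClosed {p : (Em m × Mat n) × Mat n | Antitone (diagVals g p.1 p.2)} := by
    rw [hA]
    exact isClosed_iInter fun i => isClosed_iInter fun j => isClosed_iInter fun _ =>
      isClosed_le (hl j) (hl i)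
  exact hcl

/-- The entries of `Pᵀ (g'(x) v) P`. -/
noncomputable def derivEntry {m n : ℕ} (g : Em m → Mat n) (x : Em m) (P : Mat n) (v : Em m)
    (i j : Fin n) : ℝ :=
  (Pᵀ * fderiv ℝ g x v * P) i j

theorem continuous_derivEntry {m n : ℕ} {g : Em m → Mat n} (hg : ContDiff ℝ 2 g)
    {X : Type*} [TopologicalSpace X] {x v : X → Em m} {P : X → Mat n} (hx : Continuous x)
    (hP : Continuous P) (hv : Continuous v) (i j : Fin n) :
    Continuous fun p => derivEntry g (x p) (P p) (v p) i j := by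
  have hc : Continuous fun p => (P p)ᵀ * fderiv ℝ g (x p) (v p) * P p :=
    (hP.matrix_transpose.matrix_mul
      ((continuous_fderiv_mat hg).comp (hx.prodMk hv))).matrix_mul hP
  exact hc.matrix_elem i j

/-- Identity outside the principal block indexed by `s`, antisymmetric part on that block. -/
noncomputable def blockSkew {n : ℕ} (s : Fin n → Prop) (B : Fin n → Fin n → ℝ) (i j : Fin n) : ℝ :=
  if s i ∧ s j then (B i j - B j i) / 2 else B i j

/-- The map `(v, B) ↦ Pᵀ (g'(x) v) P + blockSkew s B`, whose surjectivity encodes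
constraint qualifications. -/
noncomputable def cqMap {m n : ℕ} (g : Em m → Mat n) (s : Fin n → Prop) (x : Em m) (P : Mat n) :
    Em m × (Fin n → Fin n → ℝ) →ₗ[ℝ] (Fin n → Fin n → ℝ) where
  toFun p i j := derivEntry g x P p.1 i j + blockSkew s p.2 i j
  map_add' p q := by
    funext i j
    simp only [derivEntry, blockSkew, Prod.fst_add, Prod.snd_add, map_add, Pi.add_apply,
      Matrix.mul_add, Matrix.add_mul, Matrix.add_apply]
    split_ifs <;> ring
  map_smul' c p := by
    funext i j
    simp only [derivEntry, blockSkew, Prod.smul_fst, Prod.smul_snd, map_smul, Pi.smul_apply,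
      Matrix.mul_smul, Matrix.smul_mul, Matrix.smul_apply, smul_eq_mul, RingHom.id_apply]
    split_ifs <;> ring

theorem cqMap_surjective_of_cNondeg {m n : ℕ} {g : Em m → Mat n} {z : Em m × Mat n} {P : Mat n}
    {lam : Fin n → ℝ} (hP : IsEigDecomp (Gmap g z) P lam) (h : CNondeg g z) :
    Function.Surjective (cqMap g (fun i => lam i ≤ 0) z.1 P) := by
  intro Y
  let S : Mat n := Matrix.of fun i j => (Y i j + Y j i) / 2
  have hS : S.IsSymm := by
    ext i j
    simp only [S, Matrix.transpose_apply, Matrix.of_apply]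
    ring
  obtain ⟨v, B, hB, h1, h2, h3, hC⟩ := h P lam hP (P * S * Pᵀ) (isSymm_conj hS P)
  have hSB : S = Pᵀ * fderiv ℝ g z.1 v * P + B := by
    rw [← hP.1.conj_cancel S, hC, Matrix.mul_add, Matrix.add_mul, hP.1.conj_cancel]
  refine ⟨(v, fun i j => B i j + (Y i j - Y j i) / 2), ?_⟩
  funext i j
  have hij := congrFun (congrFun hSB i) j
  simp only [S, Matrix.of_apply, Matrix.add_apply] at hij
  have hsym := hB.apply i j
  have hval : cqMap g (fun i => lam i ≤ 0) z.1 P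
      (v, fun i j => B i j + (Y i j - Y j i) / 2) i j = (Pᵀ * fderiv ℝ g z.1 v * P) i j +
        blockSkew (fun i => lam i ≤ 0) (fun i j => B i j + (Y i j - Y j i) / 2) i j := rfl
  rw [hval, blockSkew]
  split_ifs with hs
  · have hB0 : B i j = 0 := by
      rcases hs.1.lt_or_eq with hi | hi <;> rcases hs.2.lt_or_eq with hj | hj
      · exact h3 i j hi hj
      · rw [← hsym]
        exact h2 j i hj hi
      · exact h2 i j hi hj
      · exact h1 i j hi hj
    linarith
  · linarith

theorem exists_eq_add_conj_of_cqMap_surjective {m n : ℕ} {g : Em m → Mat n}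
    (hg : ContDiff ℝ 2 g) (hgs : ∀ x, (g x).IsSymm) {s : Fin n → Prop} {x : Em m} {P : Mat n}
    (hP : IsOrthoMat P) (h : Function.Surjective (cqMap g s x P)) {C : Mat n} (hC : C.IsSymm) :
    ∃ (v : Em m) (B : Mat n), B.IsSymm ∧ (∀ i j, s i → s j → B i j = 0) ∧
      C = fderiv ℝ g x v + P * B * Pᵀ := by
  obtain ⟨⟨v, B⟩, hv⟩ := h fun i j => (Pᵀ * C * P) i j
  have hsymm : (Pᵀ * (C - fderiv ℝ g x v) * P).IsSymm :=
    isSymm_conj' (hC.sub (fderiv_isSymm hg hgs x v)) P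
  refine ⟨v, Pᵀ * (C - fderiv ℝ g x v) * P, hsymm, fun i j hi hj => ?_, ?_⟩
  · have key : ∀ k l, s k → s l →
        (Pᵀ * (C - fderiv ℝ g x v) * P) k l = (B k l - B l k) / 2 := by
      intro k l hk hl
      have := congrFun (congrFun hv k) l
      change (Pᵀ * fderiv ℝ g x v * P) k l + blockSkew s B k l = _ at this
      rw [blockSkew, if_pos ⟨hk, hl⟩] at this
      rw [Matrix.mul_sub, Matrix.sub_mul, Matrix.sub_apply]
      linarith
    have h1 := key i j hi hj
    have h2 := key j i hj hi
    rw [hsymm.apply i j] at h2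
    linarith
  · rw [hP.conj_cancel']
    abel

theorem eventually_cqMap_surjective {m n : ℕ} {g : Em m → Mat n} (hg : ContDiff ℝ 2 g)
    {s : Fin n → Prop} {x : Em m} {P : Mat n} (h : Function.Surjective (cqMap g s x P)) :
    ∀ᶠ p : Em m × Mat n in nhds (x, P), Function.Surjective (cqMap g s p.1 p.2) := by
  let b := Module.finBasis ℝ (Fin n → Fin n → ℝ)
  choose u hu using fun k => h (b k)
  have hcont : Continuous fun p : Em m × Mat n => fun k => cqMap g s p.1 p.2 (u k) := by
    refine continuous_pi fun k => continuous_pi fun i => continuous_pi fun j => ?_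
    exact (continuous_derivEntry hg continuous_fst continuous_snd continuous_const i j).add
      continuous_const
  have hli : LinearIndependent ℝ fun k => cqMap g s x P (u k) := by
    simp only [hu]
    exact b.linearIndependent
  filter_upwards [hcont.continuousAt.eventually (isOpen_setOfPred_linearIndependent.mem_nhds hli)]
    with p hp
  have hspan := LinearIndependent.span_eq_top_of_card_eq_finrank' hp (by simp)
  rw [← LinearMap.range_eq_top, eq_top_iff, ← hspan, Submodule.span_le]
  rintro _ ⟨k, rfl⟩
  exact ⟨u k, rfl⟩

theorem eventually_pos_diagVals {m n : ℕ} {g : Em m → Mat n} (hg : ContDiff ℝ 2 g)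
    (z : Em m × Mat n) (P : Mat n) :
    ∀ᶠ p : (Em m × Mat n) × Mat n in nhds (z, P),
      ∀ i, 0 < diagVals g z P i → 0 < diagVals g p.1 p.2 i := by
  rw [Filter.eventually_all]
  intro i
  by_cases hi : 0 < diagVals g z P i
  · filter_upwards [(continuous_diagVals hg i).continuousAt.eventually (lt_mem_nhds hi)]
      with p hp _ using hp
  · exact Filter.Eventually.of_forall fun p h => absurd h hi

theorem eventually_wSRCQ {m n : ℕ} {g : Em m → Mat n} (hg : ContDiff ℝ 2 g)
    (hgs : ∀ x, (g x).IsSymm) {z : Em m × Mat n} (h : CNondeg g z) :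
    ∀ᶠ z' in nhds z, WSRCQ g z' := by
  have key : ∀ᶠ z' in nhds z, ∀ P ∈ {P : Mat n | IsOrthoMat P},
      IsEigDecomp (Gmap g z') P (diagVals g z' P) → ∃ s : Fin n → Prop,
        (∀ i, diagVals g z' P i ≤ 0 → s i) ∧ Function.Surjective (cqMap g s z'.1 P) := by
    refine (isCompact_isOrthoMat n).eventually_forall_of_forall_eventually fun P _ => ?_
    by_cases hP : IsEigDecomp (Gmap g z) P (diagVals g z P)
    · have hc : Continuous fun p : (Em m × Mat n) × Mat n => (p.1.1, p.2) := by fun_prop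
      filter_upwards [eventually_pos_diagVals hg z P,
        (hc.tendsto (z, P)).eventually
          (eventually_cqMap_surjective hg (cqMap_surjective_of_cNondeg hP h))] with p hp hs _
      exact ⟨_, fun i hi => not_lt.mp fun hpos => absurd (hp i hpos) (not_lt.mpr hi), hs⟩
    · filter_upwards [(isClosed_isEigDecomp hg).isOpen_compl.mem_nhds hP] with p hp hp'
      exact absurd hp' hp
  filter_upwards [key] with z' hz' P lam hP C hC
  obtain rfl := hP.eq_diagVals
  obtain ⟨s, hs, hsurj⟩ := hz' P hP.1 hP
  obtain ⟨v, B, hB, hB0, hCeq⟩ := exists_eq_add_conj_of_cqMap_surjective hg hgs hP.1 hsurj hC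
  exact ⟨v, B, hB, fun i j hi hj => hB0 i j (hs i hi.le) (hs j hj.le),
    fun i j hi hj => hB0 i j (hs i hi.le) (hs j hj.le), hCeq⟩

/-- The summand of index `(i, j)` in the quadratic form `Qform`. -/
noncomputable def sigmaTerm {m n : ℕ} (g : Em m → Mat n) (x : Em m) (P : Mat n) (lam : Fin n → ℝ)
    (v : Em m) (i j : Fin n) : ℝ :=
  if 0 < lam i ∧ lam j < 0 then (-lam j / lam i) * derivEntry g x P v i j ^ 2 else 0

theorem sigmaTerm_nonneg {m n : ℕ} (g : Em m → Mat n) (x : Em m) (P : Mat n) (lam : Fin n → ℝ)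
    (v : Em m) (i j : Fin n) : 0 ≤ sigmaTerm g x P lam v i j := by
  unfold sigmaTerm
  split_ifs with h
  · have h1 := h.1
    have h2 : 0 < -lam j := neg_pos.mpr h.2
    positivity
  · exact le_rfl

theorem Qform_eq {m n : ℕ} (f : Em m → ℝ) (g : Em m → Mat n) (z : Em m × Mat n) (P : Mat n)
    (lam : Fin n → ℝ) (v : Em m) :
    Qform f g z P lam v =
      ⟪v, hessL f g z.1 z.2 v⟫ + 2 * ∑ i, ∑ j, sigmaTerm g z.1 P lam v i j :=
  rfl

theorem derivEntry_smul {m n : ℕ} (g : Em m → Mat n) (x : Em m) (P : Mat n) (a : ℝ) (v : Em m)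
    (i j : Fin n) : derivEntry g x P (a • v) i j = a * derivEntry g x P v i j := by
  simp [derivEntry]

theorem Qform_smul {m n : ℕ} (f : Em m → ℝ) (g : Em m → Mat n) (z : Em m × Mat n) (P : Mat n)
    (lam : Fin n → ℝ) (a : ℝ) (v : Em m) :
    Qform f g z P lam (a • v) = a ^ 2 * Qform f g z P lam v := by
  have h : ∀ i j, sigmaTerm g z.1 P lam (a • v) i j = a ^ 2 * sigmaTerm g z.1 P lam v i j := by
    intro i j
    simp only [sigmaTerm, derivEntry_smul]
    split_ifs <;> ring
  simp only [Qform_eq, h, ← Finset.mul_sum, map_smul, inner_smul_left, inner_smul_right]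
  simp only [conj_trivial]
  ring

theorem memAppl.smul {m n : ℕ} {g : Em m → Mat n} {z : Em m × Mat n} {P : Mat n}
    {lam : Fin n → ℝ} {v : Em m} (h : memAppl g z P lam v) (a : ℝ) :
    memAppl g z P lam (a • v) := by
  have key : ∀ i j, (Pᵀ * fderiv ℝ g z.1 v * P) i j = 0 →
      (Pᵀ * fderiv ℝ g z.1 (a • v) * P) i j = 0 := by
    intro i j hij
    have := derivEntry_smul g z.1 P a v i j
    rw [derivEntry, derivEntry, hij, mul_zero] at this
    exact this
  exact ⟨fun i j hi hj => key i j (h.1 i j hi hj), fun i j hi hj => key i j (h.2.1 i j hi hj),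
    fun i j hi hj => key i j (h.2.2 i j hi hj)⟩

theorem eventually_le_Qform {m n : ℕ} {f : Em m → ℝ} {g : Em m → Mat n}
    (hf : ContDiff ℝ 2 f) (hg : ContDiff ℝ 2 g) {X : Type*} [TopologicalSpace X]
    {ζ : X → Em m × Mat n} {c : X → ℝ} {R : X → Mat n} {w : X → Em m} (hζ : Continuous ζ)
    (hc : Continuous c) (hR : Continuous R) (hw : Continuous w) {a : X} (hca : c a = 0)
    (h : SSOSC f g (ζ a)) (hP : IsEigDecomp (Gmap g (ζ a)) (R a) (diagVals g (ζ a) (R a)))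
    (hv : w a ≠ 0) :
    ∀ᶠ p in nhds a, memAppl g (ζ p) (R p) (diagVals g (ζ p) (R p)) (w p) →
      c p ≤ Qform f g (ζ p) (R p) (diagVals g (ζ p) (R p)) (w p) := by
  have hlam : ∀ i, Continuous fun p => diagVals g (ζ p) (R p) i :=
    fun i => (continuous_diagVals hg i).comp (hζ.prodMk hR)
  have hent : ∀ i j, Continuous fun p => derivEntry g (ζ p).1 (R p) (w p) i j :=
    fun i j => continuous_derivEntry hg (by fun_prop) (by fun_prop) (by fun_prop) i j
  have hhess : Continuous fun p => ⟪w p, hessL f g (ζ p).1 (ζ p).2 (w p)⟫ :=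
    continuous_inner_hessL hf hg (by fun_prop) (by fun_prop) (by fun_prop)
  have hneg : ∀ i, diagVals g (ζ a) (R a) i < 0 →
      ∀ᶠ p in nhds a, diagVals g (ζ p) (R p) i < 0 := fun i hi =>
    ((hlam i).tendsto a).eventually (gt_mem_nhds hi)
  by_cases hA : ∀ i j, diagVals g (ζ a) (R a) i ≤ 0 → diagVals g (ζ a) (R a) j < 0 →
      derivEntry g (ζ a).1 (R a) (w a) i j = 0
  · have hQ : 0 < Qform f g (ζ a) (R a) (diagVals g (ζ a) (R a)) (w a) :=
      h (R a) _ hP (w a) hv ⟨fun i j hi hj => hA i j hi.le hj, fun i j hi hj => hA i j hi.le hj⟩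
    have hlow : ∀ i j, ∃ φ : X → ℝ,
        ContinuousAt φ a ∧ φ a = sigmaTerm g (ζ a).1 (R a) (diagVals g (ζ a) (R a)) (w a) i j ∧
        ∀ᶠ p in nhds a, φ p ≤ sigmaTerm g (ζ p).1 (R p) (diagVals g (ζ p) (R p)) (w p) i j := by
      intro i j
      by_cases hij : 0 < diagVals g (ζ a) (R a) i ∧ diagVals g (ζ a) (R a) j < 0
      · refine ⟨fun p => -diagVals g (ζ p) (R p) j / diagVals g (ζ p) (R p) i *
          derivEntry g (ζ p).1 (R p) (w p) i j ^ 2, ?_, ?_, ?_⟩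
        · exact ((hlam j).neg.continuousAt.div (hlam i).continuousAt hij.1.ne').mul
            ((hent i j).pow 2).continuousAt
        · rw [sigmaTerm, if_pos hij]
        · filter_upwards [hneg j hij.2,
            ((hlam i).tendsto a).eventually (lt_mem_nhds hij.1)] with p hj hi
          rw [sigmaTerm, if_pos ⟨hi, hj⟩]
      · refine ⟨fun _ => 0, continuousAt_const, ?_, ?_⟩
        · rw [sigmaTerm, if_neg hij]
        · exact Filter.Eventually.of_forall fun p => sigmaTerm_nonneg _ _ _ _ _ _ _
    choose φ hφc hφ0 hφ using hlow
    have hgap : ContinuousAt (fun p =>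
        ⟪w p, hessL f g (ζ p).1 (ζ p).2 (w p)⟫ + 2 * ∑ i, ∑ j, φ i j p - c p) a := by
      refine (hhess.continuousAt.add (continuousAt_const.mul ?_)).sub hc.continuousAt
      exact tendsto_finsetSum _ fun i _ => tendsto_finsetSum _ fun j _ => hφc i j
    have hgap0 : (0 : ℝ) < ⟪w a, hessL f g (ζ a).1 (ζ a).2 (w a)⟫ +
        2 * ∑ i, ∑ j, φ i j a - c a := by
      simp only [hφ0, hca, sub_zero]
      exact hQ
    have hφ' := Filter.eventually_all.mpr fun i => Filter.eventually_all.mpr fun j => hφ i j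
    filter_upwards [hgap.eventually (lt_mem_nhds hgap0), hφ'] with p hp hle _
    have hsum := Finset.sum_le_sum fun i (_ : i ∈ Finset.univ) =>
      Finset.sum_le_sum fun j (_ : j ∈ Finset.univ) => hle i j
    rw [Qform_eq]
    linarith
  · push Not at hA
    obtain ⟨i, j, hi, hj, hne⟩ := hA
    have hgap : Continuous fun p =>
        (⟪w p, hessL f g (ζ p).1 (ζ p).2 (w p)⟫ - c p) * diagVals g (ζ p) (R p) i +
          2 * (-diagVals g (ζ p) (R p) j * derivEntry g (ζ p).1 (R p) (w p) i j ^ 2) :=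
      ((hhess.sub hc).mul (hlam i)).add
        (continuous_const.mul ((hlam j).neg.mul ((hent i j).pow 2)))
    have hent0 : ∀ᶠ p in nhds a, derivEntry g (ζ p).1 (R p) (w p) i j ≠ 0 :=
      ((hent i j).tendsto a).eventually (isOpen_ne.mem_nhds hne)
    have hpos : ∀ p, memAppl g (ζ p) (R p) (diagVals g (ζ p) (R p)) (w p) →
        diagVals g (ζ p) (R p) j < 0 → derivEntry g (ζ p).1 (R p) (w p) i j ≠ 0 →
        0 < diagVals g (ζ p) (R p) i := by
      intro p hp hj' he
      by_contra hle
      rcases (not_lt.mp hle).lt_or_eq with hlt | heq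
      · exact he (hp.2.2 i j hlt hj')
      · exact he (hp.2.1 i j heq hj')
    rcases hi.lt_or_eq with hlt | heq
    · filter_upwards [hneg j hj, hneg i hlt, hent0] with p hj' hi' he hp
      exact absurd (hpos p hp hj' he) (not_lt.mpr hi'.le)
    · have hgap0 : (0 : ℝ) < (⟪w a, hessL f g (ζ a).1 (ζ a).2 (w a)⟫ - c a) *
          diagVals g (ζ a) (R a) i +
            2 * (-diagVals g (ζ a) (R a) j * derivEntry g (ζ a).1 (R a) (w a) i j ^ 2) := by
        have hj' : 0 < -diagVals g (ζ a) (R a) j := neg_pos.mpr hj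
        rw [heq, mul_zero, zero_add]
        positivity
      filter_upwards [hneg j hj, hent0,
        (hgap.tendsto a).eventually (lt_mem_nhds hgap0)] with p hj' he hgp hp
      have hi' := hpos p hp hj' he
      have hterm : sigmaTerm g (ζ p).1 (R p) (diagVals g (ζ p) (R p)) (w p) i j ≤
          ∑ k, ∑ l, sigmaTerm g (ζ p).1 (R p) (diagVals g (ζ p) (R p)) (w p) k l :=
        (Finset.single_le_sum (fun l _ => sigmaTerm_nonneg g _ _ _ _ i l)
          (Finset.mem_univ j)).trans
        (Finset.single_le_sum
          (f := fun k => ∑ l, sigmaTerm g (ζ p).1 (R p) (diagVals g (ζ p) (R p)) (w p) k l)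
          (fun k _ => Finset.sum_nonneg fun l _ => sigmaTerm_nonneg g _ _ _ _ k l)
          (Finset.mem_univ i))
      have hmul : sigmaTerm g (ζ p).1 (R p) (diagVals g (ζ p) (R p)) (w p) i j *
          diagVals g (ζ p) (R p) i =
          -diagVals g (ζ p) (R p) j * derivEntry g (ζ p).1 (R p) (w p) i j ^ 2 := by
        rw [sigmaTerm, if_pos ⟨hi', hj'⟩]
        field_simp
      have hfac : 0 < (⟪w p, hessL f g (ζ p).1 (ζ p).2 (w p)⟫ - c p +
          2 * sigmaTerm g (ζ p).1 (R p) (diagVals g (ζ p) (R p)) (w p) i j) *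
          diagVals g (ζ p) (R p) i := by
        rw [add_mul, mul_assoc 2, hmul]
        exact hgp
      have hlt := pos_of_mul_pos_left hfac hi'.le
      rw [Qform_eq]
      linarith

theorem exists_unif_wSOC {m n : ℕ} {f : Em m → ℝ} {g : Em m → Mat n}
    (hf : ContDiff ℝ 2 f) (hg : ContDiff ℝ 2 g) {z : Em m × Mat n} (h : SSOSC f g z) :
    ∃ c : ℝ, 0 < c ∧ ∀ᶠ z' in nhds z, ∀ P lam, IsEigDecomp (Gmap g z') P lam →
      ∀ v : Em m, memAppl g z' P lam v → c * ‖v‖ ^ 2 ≤ Qform f g z' P lam v := by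
  have key : ∀ᶠ q : (Em m × Mat n) × ℝ in nhds (z, 0),
      ∀ r ∈ {P : Mat n | IsOrthoMat P} ×ˢ Metric.sphere (0 : Em m) 1,
        IsEigDecomp (Gmap g q.1) r.1 (diagVals g q.1 r.1) →
        memAppl g q.1 r.1 (diagVals g q.1 r.1) r.2 →
          q.2 ≤ Qform f g q.1 r.1 (diagVals g q.1 r.1) r.2 := by
    refine ((isCompact_isOrthoMat n).prod
      (isCompact_sphere _ _)).eventually_forall_of_forall_eventually ?_
    rintro ⟨P, v⟩ ⟨_, hv⟩
    by_cases hP : IsEigDecomp (Gmap g z) P (diagVals g z P)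
    · filter_upwards [eventually_le_Qform hf hg (a := ((z, 0), (P, v)))
        (continuous_fst.comp continuous_fst) (continuous_snd.comp continuous_fst)
        (continuous_fst.comp continuous_snd) (continuous_snd.comp continuous_snd) rfl h hP
        (ne_zero_of_mem_unit_sphere ⟨v, hv⟩)] with p hp _ using hp
    · have hzP : Continuous fun p : ((Em m × Mat n) × ℝ) × (Mat n × Em m) => (p.1.1, p.2.1) := by
        fun_prop
      filter_upwards [(hzP.tendsto ((z, 0), (P, v))).eventually
        ((isClosed_isEigDecomp hg).isOpen_compl.mem_nhds hP)] with p hp hp'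
      exact absurd hp' hp
  rw [nhds_prod_eq] at key
  obtain ⟨A, hA, B, hB, hAB⟩ := Filter.eventually_prod_iff.mp key
  obtain ⟨ε, hε, hball⟩ := Metric.eventually_nhds_iff.mp hB
  refine ⟨ε / 2, half_pos hε, ?_⟩
  filter_upwards [hA] with z' hz' P lam hP v hv
  obtain rfl := hP.eq_diagVals
  by_cases hv0 : v = 0
  · subst hv0
    simp [Qform]
  · have hn : 0 < ‖v‖ := norm_pos_iff.mpr hv0
    have hBε : B (ε / 2) := hball (by
      rw [Real.dist_eq, sub_zero, abs_of_pos (half_pos hε)]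
      exact half_lt_self hε)
    have hu : ‖v‖⁻¹ • v ∈ Metric.sphere (0 : Em m) 1 := by
      rw [mem_sphere_zero_iff_norm, norm_smul, norm_inv, norm_norm, inv_mul_cancel₀ hn.ne']
    have hle := hAB hz' hBε (P, ‖v‖⁻¹ • v) ⟨hP.1, hu⟩ hP (hv.smul _)
    simp only [Qform_smul] at hle
    calc ε / 2 * ‖v‖ ^ 2 ≤ (‖v‖⁻¹ ^ 2 * Qform f g z' P (diagVals g z' P) v) * ‖v‖ ^ 2 := by
          gcongr
      _ = Qform f g z' P (diagVals g z' P) v := by field_simp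

/-- The eigenvalues `lam` with all zero eigenvalues replaced by `t`. -/
noncomputable def shiftZero {n : ℕ} (lam : Fin n → ℝ) (t : ℝ) (i : Fin n) : ℝ :=
  if lam i = 0 then t else lam i

theorem eventually_antitone_shiftZero {n : ℕ} {lam : Fin n → ℝ} (h : Antitone lam) :
    ∀ᶠ t in nhds (0 : ℝ), Antitone (shiftZero lam t) := by
  have key : ∀ᶠ t in nhds (0 : ℝ), ∀ i, (0 < lam i → t < lam i) ∧ (lam i < 0 → lam i < t) := by
    refine Filter.eventually_all.mpr fun i => ?_
    rcases lt_trichotomy (lam i) 0 with hi | hi | hi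
    · filter_upwards [lt_mem_nhds hi] with t ht
      exact ⟨fun h' => absurd h' hi.not_gt, fun _ => ht⟩
    · exact Filter.Eventually.of_forall fun t => by simp [hi]
    · filter_upwards [gt_mem_nhds hi] with t ht
      exact ⟨fun _ => ht, fun h' => absurd h' hi.not_gt⟩
  filter_upwards [key] with t ht i j hij
  have hle := h hij
  unfold shiftZero
  split_ifs with hj hi hi
  · exact le_rfl
  · exact ((ht i).1 (lt_of_le_of_ne (hj ▸ hle) (Ne.symm hi))).le
  · exact ((ht j).2 (lt_of_le_of_ne (hi ▸ hle) hj)).le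
  · exact hle

/-- The multiplier `y` moved by `t` along the kernel of `P Diag(lam) Pᵀ`. -/
noncomputable def shiftPoint {m n : ℕ} (z : Em m × Mat n) (P : Mat n) (lam : Fin n → ℝ) (t : ℝ) :
    Em m × Mat n :=
  (z.1, z.2 + P * Matrix.diagonal (fun i => if lam i = 0 then t else 0) * Pᵀ)

theorem continuous_shiftPoint {m n : ℕ} (z : Em m × Mat n) (P : Mat n) (lam : Fin n → ℝ) :
    Continuous (shiftPoint z P lam) := by
  have hd : Continuous fun t : ℝ => fun i => if lam i = 0 then t else 0 :=
    continuous_pi fun i => by split_ifs <;> fun_prop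
  exact continuous_const.prodMk (continuous_const.add
    ((continuous_const.matrix_mul hd.matrix_diagonal).matrix_mul continuous_const))

theorem shiftPoint_zero {m n : ℕ} (z : Em m × Mat n) (P : Mat n) (lam : Fin n → ℝ) :
    shiftPoint z P lam 0 = z := by
  simp [shiftPoint]

theorem shiftPoint_isSymm {m n : ℕ} {z : Em m × Mat n} (hz : z.2.IsSymm) (P : Mat n)
    (lam : Fin n → ℝ) (t : ℝ) : (shiftPoint z P lam t).2.IsSymm :=
  hz.add (isSymm_conj (Matrix.diagonal_transpose _) P)

theorem isEigDecomp_shiftPoint {m n : ℕ} {g : Em m → Mat n} {z : Em m × Mat n} {P : Mat n}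
    {lam : Fin n → ℝ} (h : IsEigDecomp (Gmap g z) P lam) {t : ℝ}
    (ht : Antitone (shiftZero lam t)) :
    IsEigDecomp (Gmap g (shiftPoint z P lam t)) P (shiftZero lam t) := by
  refine ⟨h.1, ht, ?_⟩
  have h1 : Gmap g (shiftPoint z P lam t) =
      Gmap g z + P * Matrix.diagonal (fun i => if lam i = 0 then t else 0) * Pᵀ := by
    simp only [Gmap, shiftPoint, add_assoc]
  rw [h1, h.2.2, ← Matrix.add_mul, ← Matrix.mul_add, Matrix.diagonal_add]
  congr 3
  funext i
  unfold shiftZero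
  split_ifs with hi
  · rw [hi, zero_add]
  · rw [add_zero]

theorem eventually_shiftPoint_mem {m n : ℕ} {z : Em m × Mat n} (P : Mat n) (lam : Fin n → ℝ)
    {U : Set (Em m × Mat n)} (hU : IsOpen U) (hz : z ∈ U) :
    ∀ᶠ t in nhds (0 : ℝ), shiftPoint z P lam t ∈ U :=
  (continuous_shiftPoint z P lam).continuousAt.eventually
    (hU.mem_nhds (by rwa [shiftPoint_zero]))

theorem cNondeg_of_wSRCQ {m n : ℕ} {g : Em m → Mat n} {z : Em m × Mat n} (hz : z.2.IsSymm)
    {U : Set (Em m × Mat n)} (hU : IsOpen U) (hzU : z ∈ U)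
    (h : ∀ z ∈ U, z.2.IsSymm → WSRCQ g z) : CNondeg g z := by
  intro P lam hP C hC
  have hev := ((eventually_antitone_shiftZero hP.2.1).and
    (eventually_shiftPoint_mem P lam hU hzU)).filter_mono (nhdsWithin_le_nhds (s := Iio 0))
  obtain ⟨t, ⟨hanti, hmem⟩, ht : t < 0⟩ := (hev.and self_mem_nhdsWithin).exists
  obtain ⟨v, B, hB, -, hB0, hCeq⟩ := h _ hmem (shiftPoint_isSymm hz P lam t) P _
    (isEigDecomp_shiftPoint hP hanti) C hC
  have hneg : ∀ i, lam i ≤ 0 → shiftZero lam t i < 0 := by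
    intro i hi
    unfold shiftZero
    split_ifs with h0
    · exact ht
    · exact lt_of_le_of_ne hi h0
  exact ⟨v, B, hB, fun i j hi hj => hB0 i j (hneg i hi.le) (hneg j hj.le),
    fun i j hi hj => hB0 i j (hneg i hi.le) (hneg j hj.le),
    fun i j hi hj => hB0 i j (hneg i hi.le) (hneg j hj.le), hCeq⟩

theorem sSOSC_of_unifWSOC {m n : ℕ} {f : Em m → ℝ} {g : Em m → Mat n}
    (hf : ContDiff ℝ 2 f) (hg : ContDiff ℝ 2 g) {z : Em m × Mat n} (hz : z.2.IsSymm)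
    {U : Set (Em m × Mat n)} (hU : IsOpen U) (hzU : z ∈ U) (h : UnifWSOC f g U) :
    SSOSC f g z := by
  obtain ⟨c, hc, h⟩ := h
  intro P lam hP v hv happ
  have hle : ∀ᶠ t in nhdsWithin (0 : ℝ) (Ioi 0), c * ‖v‖ ^ 2 ≤
      ⟪v, hessL f g z.1 (shiftPoint z P lam t).2 v⟫ +
        2 * ∑ i, ∑ j, sigmaTerm g z.1 P lam v i j := by
    filter_upwards [(eventually_antitone_shiftZero hP.2.1).filter_mono nhdsWithin_le_nhds,
      (eventually_shiftPoint_mem P lam hU hzU).filter_mono nhdsWithin_le_nhds,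
      self_mem_nhdsWithin] with t hanti hmem ht
    have ht : 0 < t := ht
    have hne : ∀ i, shiftZero lam t i ≠ 0 := by
      intro i
      unfold shiftZero
      split_ifs with h0
      · exact ht.ne'
      · exact h0
    have hneg : ∀ i, shiftZero lam t i < 0 → lam i < 0 := by
      intro i
      unfold shiftZero
      split_ifs with h0
      · exact fun h' => absurd h' ht.not_gt
      · exact id
    have hQ := h _ hmem (shiftPoint_isSymm hz P lam t) P _ (isEigDecomp_shiftPoint hP hanti) v
      ⟨fun i j hi => absurd hi (hne i), fun i j hi => absurd hi (hne i),
        fun i j hi hj => happ.2 i j (hneg i hi) (hneg j hj)⟩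
    have hterm : ∀ i j, sigmaTerm g z.1 P (shiftZero lam t) v i j =
        sigmaTerm g z.1 P lam v i j := by
      intro i j
      by_cases hj : lam j < 0
      · have hj' : shiftZero lam t j = lam j := if_neg hj.ne
        by_cases hi : lam i = 0
        · have h0 : derivEntry g z.1 P v i j = 0 := happ.1 i j hi hj
          simp [sigmaTerm, h0]
        · have hi' : shiftZero lam t i = lam i := if_neg hi
          simp only [sigmaTerm, hi', hj']
      · rw [sigmaTerm, sigmaTerm, if_neg fun h' => hj (hneg j h'.2), if_neg fun h' => hj h'.2]
    rw [Qform_eq] at hQ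
    change c * ‖v‖ ^ 2 ≤ ⟪v, hessL f g z.1 (shiftPoint z P lam t).2 v⟫ +
      2 * ∑ i, ∑ j, sigmaTerm g z.1 P (shiftZero lam t) v i j at hQ
    simpa only [hterm] using hQ
  have hcont : Continuous fun t : ℝ => ⟪v, hessL f g z.1 (shiftPoint z P lam t).2 v⟫ +
      2 * ∑ i, ∑ j, sigmaTerm g z.1 P lam v i j :=
    (continuous_inner_hessL hf hg continuous_const
      (continuous_snd.comp (continuous_shiftPoint z P lam)) continuous_const).add continuous_const
  have hlim := ge_of_tendsto ((hcont.tendsto 0).mono_left nhdsWithin_le_nhds) hle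
  rw [shiftPoint_zero] at hlim
  have hn : 0 < ‖v‖ := norm_pos_iff.mpr hv
  exact lt_of_lt_of_le (by positivity) hlim

/-- Let `x̄` be a local minimizer of `f` over `{x : g(x) ⪰ 0}` at which
the Robinson constraint qualification holds, and let `(x̄,ȳ)` be a KKT pair. Then the
S-SOSC together with constraint nondegeneracy at `(x̄,ȳ)` is equivalent to the local
uniform validity of the W-SOC together with the local validity of the W-SRCQ. -/
theorem strong_conditions_iff_local_uniform_weak_conditions {m n : ℕ}
    (f : Em m → ℝ) (g : Em m → Mat n)
    (hf : ContDiff ℝ 2 f) (hg : ContDiff ℝ 2 g) (hgs : ∀ x, (g x).IsSymm)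
    (xbar : Em m) (ybar : Mat n) (hybar : ybar.IsSymm)
    (hmin : IsLocalMinOn f {x | (g x).PosSemidef} xbar)
    (hRCQ : ∀ P0 lam0, IsEigDecomp (g xbar) P0 lam0 →
      ∀ C : Mat n, C.IsSymm →
        ∃ (v : Em m) (H : Mat n), H.IsSymm ∧
          (∀ u : Fin n → ℝ, (∀ i, lam0 i ≠ 0 → u i = 0) →
            0 ≤ ∑ i, ∑ j, u i * (P0ᵀ * H * P0) i j * u j) ∧
          C = fderiv ℝ g xbar v + H)
    (hkkt : KKTF f g (xbar, ybar) = 0) :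
    (SSOSC f g (xbar, ybar) ∧ CNondeg g (xbar, ybar)) ↔
      ∃ U : Set (Em m × Mat n), IsOpen U ∧ (xbar, ybar) ∈ U ∧
        UnifWSOC f g U ∧ ∀ z ∈ U, z.2.IsSymm → WSRCQ g z := by
  constructor
  · rintro ⟨hS, hC⟩
    obtain ⟨c, hc, hcU⟩ := exists_unif_wSOC hf hg hS
    obtain ⟨U, hU, hUo, hzU⟩ := mem_nhds_iff.mp (hcU.and (eventually_wSRCQ hg hgs hC))
    exact ⟨U, hUo, hzU, ⟨c, hc, fun z hz _ => (hU hz).1⟩, fun z hz _ => (hU hz).2⟩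
  · rintro ⟨U, hU, hzU, hunif, hW⟩
    exact ⟨sSOSC_of_unifWSOC hf hg hybar hU hzU hunif, cNondeg_of_wSRCQ hybar hU hzU hW⟩
end
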